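/- In the chapter B setting, suppose moreover that there exists (a, b) ∈ F² \ {(0,0)} such that for every transvection σ ∈ G the pair (a_σ, b_σ) defined by σ(w₂) = w₂ + a_σ v, σ(w₁) = w₁ + b_σ v lies on the line F·(a, b) (the case dim span_F X = 1), and let |T(G)| = p^n. Then S(V)^G is Gorenstein if and only if every element of the quotient group G/T(G) has order dividing |T(G)| − 1 = p^n − 1. -/

import Mathlib

noncomputable section
open CategoryTheory Matrix MvPolynomial

universe u

/-- A module `M` over `R` has finite injective dimension iff the Ext functors
`Ext^i(-, M)` vanish for all sufficiently large `i`. -/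
def HasFiniteInjectiveDimension (R : Type u) [CommRing R] (M : ModuleCat.{u} R) : Prop :=
  ∃ n : ℕ, ∀ (N : ModuleCat.{u} R) (i : ℕ), n < i →
    Subsingleton (((Ext R (ModuleCat.{u} R) i).obj (Opposite.op N)).obj M)

/-- A commutative ring is Gorenstein if it is Noetherian and its localization at every
prime ideal has finite injective dimension over itself. -/
def IsGorensteinRing (R : Type u) [CommRing R] : Prop :=
  IsNoetherianRing R ∧ ∀ (P : Ideal R) [P.IsPrime],
    HasFiniteInjectiveDimension (Localization.AtPrime P)
      (ModuleCat.of (Localization.AtPrime P) (Localization.AtPrime P))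

/-- The substitution action of a matrix on polynomials: `X i ↦ ∑ j, M i j • X j`. -/
def polyAct {F : Type u} [CommSemiring F] {m : ℕ} (M : Matrix (Fin m) (Fin m) F) :
    MvPolynomial (Fin m) F →ₐ[F] MvPolynomial (Fin m) F :=
  MvPolynomial.aeval fun i => ∑ j, M i j • MvPolynomial.X j

/-- The subalgebra of polynomials invariant under a set of matrices. -/
def invariantAlg {F : Type u} [CommSemiring F] {m : ℕ} (S : Set (Matrix (Fin m) (Fin m) F)) :
    Subalgebra F (MvPolynomial (Fin m) F) where
  carrier := {f | ∀ M ∈ S, polyAct M f = f}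
  mul_mem' := fun hf hg => fun M hM => by rw [_root_.map_mul, hf M hM, hg M hM]
  add_mem' := fun hf hg => fun M hM => by rw [_root_.map_add, hf M hM, hg M hM]
  algebraMap_mem' := fun r => fun M hM => (polyAct M).commutes r

/-- The invariant ring `S(V)^G` for a subgroup `G` of `SL(m, F)`, where `S(V)` is realised
as the polynomial ring `F[X 0, …, X (m-1)]`. -/
def invariantRing {F : Type u} [Field F] {m : ℕ}
    (G : Subgroup (Matrix.SpecialLinearGroup (Fin m) F)) :
    Subalgebra F (MvPolynomial (Fin m) F) :=
  invariantAlg {M | ∃ g ∈ G, (g : Matrix (Fin m) (Fin m) F) = M}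

/-- A matrix `M` is a transvection if `rank (M - 1) = 1` and `(M - 1)² = 0`. -/
def IsTransvectionMat {F : Type u} [Field F] {m : ℕ} (M : Matrix (Fin m) (Fin m) F) : Prop :=
  (M - 1).rank = 1 ∧ (M - 1) * (M - 1) = 0

/-- `T(G)`: the subgroup generated by all transvections contained in `G`. -/
def transSubgroup {F : Type u} [Field F] {m : ℕ}
    (G : Subgroup (Matrix.SpecialLinearGroup (Fin m) F)) :
    Subgroup (Matrix.SpecialLinearGroup (Fin m) F) :=
  Subgroup.closure {g | g ∈ G ∧ IsTransvectionMat (g : Matrix (Fin m) (Fin m) F)}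

/-- Over a module category, the derived-functor `Ext` in positive degree vanishes iff the
derived-category `Ext` does. -/
theorem subsingleton_ext_succ_iff {R : Type u} [CommRing R] (N M : ModuleCat.{u} R) (i : ℕ) :
    Subsingleton (((Ext R (ModuleCat.{u} R) (i + 1)).obj (Opposite.op N)).obj M) ↔
      Subsingleton (Abelian.Ext.{u} N M (i + 1)) := by
  let P := projectiveResolution N
  rw [← ModuleCat.isZero_iff_subsingleton, (P.isoExt (R := R) (i + 1) M).isZero_iff,
    ← HomologicalComplex.exactAt_iff_isZero_homology,
    HomologicalComplex.exactAt_iff' _ i (i + 1) (i + 2) (by simp) (by simp),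
    ShortComplex.moduleCat_exact_iff]
  constructor
  · intro h
    refine subsingleton_of_forall_eq 0 fun e => ?_
    obtain ⟨f, hf, rfl⟩ := P.extMk_surjective e (i + 2) rfl
    rw [P.extMk_eq_zero_iff f (i + 2) rfl hf i rfl]
    exact h f hf
  · intro h f hf
    have := (P.extMk_eq_zero_iff f (i + 2) rfl hf i rfl).1 (Subsingleton.elim _ _)
    exact this

theorem hasFiniteInjectiveDimension_iff {R : Type u} [CommRing R] (M : ModuleCat.{u} R) :
    HasFiniteInjectiveDimension R M ↔ ∃ n : ℕ, HasInjectiveDimensionLT M n := by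
  constructor
  · rintro ⟨n, hn⟩
    refine ⟨n + 1, HasInjectiveDimensionLT.mk fun i hi Y e => ?_⟩
    obtain ⟨j, rfl⟩ : ∃ j, i = j + 1 := ⟨i - 1, by omega⟩
    have := (subsingleton_ext_succ_iff Y M j).1 (hn Y (j + 1) (by omega))
    exact Subsingleton.elim _ _
  · rintro ⟨n, hn⟩
    refine ⟨n, fun N i hi => ?_⟩
    obtain ⟨j, rfl⟩ : ∃ j, i = j + 1 := ⟨i - 1, by omega⟩
    exact (subsingleton_ext_succ_iff N M j).2
      (HasInjectiveDimensionLT.subsingleton M n _ (by omega) N)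

open RingTheory.Sequence in
/-- If precomposition with `ι : K → M` is surjective on `Ext^d(-, L)`, where `d` is the length of
an `L`-regular sequence killing `K` and `M`, then every map from `K` to the quotient of `L` by this
sequence extends to `M`. -/
theorem exists_extension_of_isRegular {R : Type u} [CommRing R] [IsNoetherianRing R]
    {K M : ModuleCat.{u} R} [Module.Finite R K] (ι : K ⟶ M) (rs : List R) :
    ∀ (L : ModuleCat.{u} R) [Module.Finite R L], IsRegular L rs →
      (∀ r ∈ rs, r ∈ Module.annihilator R K) → (∀ r ∈ rs, r ∈ Module.annihilator R M) →
      Function.Surjective ((Abelian.Ext.mk₀ ι).precomp L (zero_add rs.length)) →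
      ∀ f : K →ₗ[R] L ⧸ (Ideal.ofList rs • ⊤ : Submodule R L),
        ∃ g : M →ₗ[R] L ⧸ (Ideal.ofList rs • ⊤ : Submodule R L), g ∘ₗ ι.hom = f := by
  induction rs with
  | nil =>
    intro L _ _ _ _ hsurj f
    have hbot : (Ideal.ofList ([] : List R) • ⊤ : Submodule R L) = ⊥ := by
      rw [Ideal.ofList_nil]; exact Submodule.bot_smul _
    let e : (L ⧸ (Ideal.ofList [] • ⊤ : Submodule R L)) ≃ₗ[R] L :=
      Submodule.quotEquivOfEqBot _ hbot
    obtain ⟨y, hy⟩ := hsurj (Abelian.Ext.mk₀ (ModuleCat.ofHom (e.toLinearMap ∘ₗ f)))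
    obtain ⟨g, rfl⟩ := (Abelian.Ext.mk₀_bijective M L).2 y
    refine ⟨e.symm.toLinearMap ∘ₗ g.hom, ?_⟩
    have h : ι ≫ g = ModuleCat.ofHom (e.toLinearMap ∘ₗ f) := by
      apply (Abelian.Ext.mk₀_bijective K L).1
      simpa using hy
    ext x
    have := congr(ModuleCat.Hom.hom $h x)
    simp only [ModuleCat.hom_comp, LinearMap.comp_apply, ModuleCat.hom_ofHom] at this
    simp [this]
  | cons r rs ih =>
    intro L _ hreg hK hM hsurj f
    have hreg' := (isRegular_cons_iff L r rs).1 hreg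
    have hS := hreg'.1.smulShortComplex_shortExact
    let e := Submodule.quotOfListConsSMulTopEquivQuotSMulTopInner L r rs
    have key : Function.Surjective ((Abelian.Ext.mk₀ ι).precomp
        (ModuleCat.of R (QuotSMulTop r L)) (zero_add rs.length)) := by
      change Function.Surjective ((Abelian.Ext.mk₀ ι).precomp (L.smulShortComplex r).X₃ _)
      intro x
      obtain ⟨z, hz⟩ := hsurj (x.comp hS.extClass rfl)
      have hz0 : z.comp (Abelian.Ext.mk₀ (L.smulShortComplex r).f) (add_zero _) = 0 := by
        have := Abelian.Ext.postcomp_smul_id_eq_zero_of_mem_annihilator (M := L)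
          (hM r (by simp)) (rs.length + 1)
        exact congr(AddCommGrpCat.Hom.hom $this z)
      obtain ⟨w, hw⟩ := Abelian.Ext.covariant_sequence_exact₁ _ hS z hz0 rfl
      have hd : ((Abelian.Ext.mk₀ ι).comp w (zero_add _) - x).comp hS.extClass rfl = 0 := by
        refine (map_sub (hS.extClass.postcomp K rfl) _ _).trans (sub_eq_zero.2 ?_)
        rw [← hw] at hz
        exact (Abelian.Ext.comp_assoc _ _ _ _ _ (by simp)).trans hz
      obtain ⟨y, hy⟩ := Abelian.Ext.covariant_sequence_exact₃ _ hS _ rfl hd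
      have hsub := ModuleCat.subsingleton_ext_of_exists_isRegular (Ideal.ofList (r :: rs)) K
        (by
          rw [Module.support_eq_zeroLocus]
          exact PrimeSpectrum.zeroLocus_anti_mono_ideal (Ideal.span_le.2 hK)) L
        hreg.top_ne_smul.symm.lt_top (r :: rs) (fun x hx => Ideal.subset_span hx) hreg
        rs.length (by simp)
      rw [show y = 0 from hsub.elim y 0, Abelian.Ext.zero_comp] at hy
      exact ⟨w, (sub_eq_zero.1 hy.symm)⟩
    obtain ⟨g, hg⟩ := ih (ModuleCat.of R (QuotSMulTop r L)) hreg'.2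
      (fun s hs => hK s (by simp [hs])) (fun s hs => hM s (by simp [hs])) key
      (e.toLinearMap ∘ₗ f)
    refine ⟨e.symm.toLinearMap ∘ₗ g, ?_⟩
    rw [LinearMap.comp_assoc, hg]
    ext x
    simp

theorem shortExact_subtype_mkQ {R : Type u} [CommRing R] {M : Type u} [AddCommGroup M] [Module R M]
    (N : Submodule R M) :
    (ModuleCat.shortComplexOfCompEqZero N.subtype N.mkQ
      (LinearMap.exact_subtype_mkQ N).linearMap_comp_eq_zero).ShortExact :=
  ModuleCat.shortComplex_shortExact _ (LinearMap.exact_subtype_mkQ N) N.subtype_injective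
    N.mkQ_surjective

theorem subsingleton_ext_of_linearEquiv {R : Type u} [CommRing R] {M N : Type u} [AddCommGroup M]
    [Module R M] [AddCommGroup N] [Module R N] (e : M ≃ₗ[R] N) (L : ModuleCat.{u} R) (i : ℕ)
    [h : Subsingleton (Abelian.Ext.{u} (ModuleCat.of R N) L i)] :
    Subsingleton (Abelian.Ext.{u} (ModuleCat.of R M) L i) := by
  refine ⟨fun x y => ?_⟩
  have key : ∀ z : Abelian.Ext.{u} (ModuleCat.of R M) L i, z = 0 := fun z => by
    have h1 : z = (Abelian.Ext.mk₀ (e.toModuleIso.hom ≫ e.toModuleIso.inv)).comp z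
      (zero_add i) := by rw [Iso.hom_inv_id, Abelian.Ext.mk₀_id_comp]
    rw [h1, ← Abelian.Ext.mk₀_comp_mk₀_assoc, Subsingleton.elim
      ((Abelian.Ext.mk₀ e.toModuleIso.inv).comp z (zero_add i)) 0, Abelian.Ext.comp_zero]
  rw [key x, key y]

theorem subsingleton_ext_of_isFiniteLength {R : Type u} [CommRing R] [IsLocalRing R]
    (L : ModuleCat.{u} R) (i : ℕ)
    (hres : Subsingleton (Abelian.Ext.{u}
      (ModuleCat.of R (R ⧸ IsLocalRing.maximalIdeal R)) L i))
    {M : Type u} [AddCommGroup M] [Module R M] (hM : IsFiniteLength R M) :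
    Subsingleton (Abelian.Ext.{u} (ModuleCat.of R M) L i) := by
  induction hM with
  | of_subsingleton =>
    have : Limits.IsZero (ModuleCat.of R ‹Type u›) := ModuleCat.isZero_of_subsingleton _
    have := this.hasProjectiveDimensionLT_zero
    exact HasProjectiveDimensionLT.subsingleton _ 0 i (by omega) L
  | @of_simple_quotient M _ _ N hN hNl ih =>
    have hq : Subsingleton (Abelian.Ext.{u} (ModuleCat.of R (M ⧸ N)) L i) := by
      obtain ⟨I, hI, ⟨e⟩⟩ := isSimpleModule_iff_quot_maximal.1 hN
      obtain rfl := IsLocalRing.eq_maximalIdeal hI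
      exact subsingleton_ext_of_linearEquiv e L i
    refine subsingleton_of_forall_eq 0 fun x => ?_
    obtain ⟨y, rfl⟩ := Abelian.Ext.contravariant_sequence_exact₂ (shortExact_subtype_mkQ N) L x
      (ih.elim _ _)
    rw [hq.elim y 0]
    exact Abelian.Ext.comp_zero _ _ _ _ _

/-- In a Noetherian local ring of finite injective dimension over itself, the socle of the
quotient by a maximal regular sequence is at most one-dimensional. -/
theorem exists_smul_eq_of_isRegular {R : Type u} [CommRing R] [IsNoetherianRing R] [IsLocalRing R]
    {N : ℕ} (hN : HasInjectiveDimensionLT (ModuleCat.of R R) N) (rs : List R)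
    (hreg : RingTheory.Sequence.IsRegular R rs)
    (hfl : IsFiniteLength R (R ⧸ (Ideal.ofList rs • ⊤ : Submodule R R)))
    (u v : R ⧸ (Ideal.ofList rs • ⊤ : Submodule R R)) (hu : u ≠ 0)
    (hmu : ∀ r ∈ IsLocalRing.maximalIdeal R, r • u = 0)
    (hmv : ∀ r ∈ IsLocalRing.maximalIdeal R, r • v = 0) :
    ∃ r : R, v = r • u := by
  let Q := R ⧸ (Ideal.ofList rs • ⊤ : Submodule R R)
  let L := ModuleCat.of R R
  have hmem : ∀ r ∈ rs, r ∈ IsLocalRing.maximalIdeal R := fun r hr =>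
    IsLocalRing.le_maximalIdeal (by simpa using hreg.top_ne_smul.symm) (Ideal.subset_span hr)
  have hpd : HasProjectiveDimensionLT (ModuleCat.of R Q) (rs.length + 1) := by
    have h1 := ModuleCat.projectiveDimension_quotient_eq_add_length_of_isWeaklyRegular L rs
      hreg.toIsWeaklyRegular hmem
    have h2 : projectiveDimension L ≤ (0 : ℕ) := by
      rw [projectiveDimension_le_iff]
      have : Projective L := (IsProjective.iff_projective (R := R) R).1 inferInstance
      infer_instance
    have h3 : projectiveDimension (ModuleCat.of R Q) ≤ (rs.length : ℕ) := by
      refine h1.trans_le ?_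
      simpa using add_le_add_left h2 (rs.length : WithBot ℕ∞)
    rwa [projectiveDimension_le_iff] at h3
  let t : R →ₗ[R] Q := LinearMap.toSpanSingleton R Q u
  have hker : LinearMap.ker t = IsLocalRing.maximalIdeal R := by
    refine ((IsLocalRing.maximalIdeal.isMaximal R).eq_of_le ?_ ?_).symm
    · intro h
      have h1 : (1 : R) ∈ LinearMap.ker t := by rw [h]; exact Submodule.mem_top
      exact hu (by simpa [t] using h1)
    · intro r hr
      exact hmu r hr
  let K := LinearMap.range t
  let e : (R ⧸ IsLocalRing.maximalIdeal R) ≃ₗ[R] K :=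
    (Submodule.quotEquivOfEq _ _ hker.symm).trans t.quotKerEquivRange
  have he : e (Ideal.Quotient.mk _ 1) = ⟨u, 1, by simp [t]⟩ := by
    apply Subtype.ext
    change t 1 = u
    simp [t]
  have hS := shortExact_subtype_mkQ K
  have hflK : IsFiniteLength R (Q ⧸ K) := by
    rw [isFiniteLength_iff_isNoetherian_isArtinian] at hfl ⊢
    have := hfl.1
    have := hfl.2
    exact ⟨inferInstance, inferInstance⟩
  have hext : ∀ j i : ℕ, rs.length < i → N ≤ i + j → ∀ {M : Type u} [AddCommGroup M]
      [Module R M], IsFiniteLength R M → Subsingleton (Abelian.Ext.{u} (ModuleCat.of R M) L i) := by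
    intro j
    induction j with
    | zero =>
      intro i _ hi M _ _ _
      exact HasInjectiveDimensionLT.subsingleton L N i hi _
    | succ j ih =>
      intro i hdi hi M _ _ hM
      refine subsingleton_ext_of_isFiniteLength L i ?_ hM
      have hQK := ih (i + 1) (by omega) (by omega) hflK
      have hQ0 := HasProjectiveDimensionLT.subsingleton (ModuleCat.of R Q) _ i hdi L
      have hK : Subsingleton (Abelian.Ext.{u} (ModuleCat.of R K) L i) := by
        refine subsingleton_of_forall_eq 0 fun x => ?_
        obtain ⟨y, rfl⟩ := Abelian.Ext.contravariant_sequence_exact₁ hS L x (add_comm 1 i)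
          (hQK.elim _ _)
        rw [hQ0.elim y 0]
        exact Abelian.Ext.comp_zero _ _ _ _ _
      exact subsingleton_ext_of_linearEquiv e L i
  have hsurj : Function.Surjective ((Abelian.Ext.mk₀ (ModuleCat.ofHom K.subtype)).precomp L
      (zero_add rs.length)) := by
    intro x
    exact Abelian.Ext.contravariant_sequence_exact₁ hS L x (add_comm 1 _)
      ((hext N _ (by omega) (by omega) hflK).elim _ _)
  have hannQ : ∀ r ∈ rs, r ∈ Module.annihilator R Q := by
    intro r hr
    rw [Module.mem_annihilator]
    intro q
    obtain ⟨q, rfl⟩ := Submodule.Quotient.mk_surjective _ q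
    rw [← Submodule.Quotient.mk_smul, Submodule.Quotient.mk_eq_zero]
    exact Submodule.smul_mem_smul (Ideal.subset_span hr) Submodule.mem_top
  let f₀ : (R ⧸ IsLocalRing.maximalIdeal R) →ₗ[R] Q :=
    Submodule.liftQ _ (LinearMap.toSpanSingleton R Q v) fun r hr => hmv r hr
  let f : K →ₗ[R] Q := f₀ ∘ₗ e.symm.toLinearMap
  have hf : f ⟨u, 1, by simp [t]⟩ = v := by
    rw [← he]
    change f₀ (e.symm (e _)) = v
    rw [e.symm_apply_apply]
    exact one_smul R v
  obtain ⟨g, hg⟩ := exists_extension_of_isRegular (K := ModuleCat.of R K) (M := ModuleCat.of R Q)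
    (ModuleCat.ofHom K.subtype) rs L hreg
    (fun r hr => Module.mem_annihilator.2 fun k => Subtype.ext
      (Module.mem_annihilator.1 (hannQ r hr) k.1)) hannQ hsurj f
  have hgu : g u = v := by
    rw [← hf, ← hg]
    rfl
  obtain ⟨b, rfl⟩ := Submodule.Quotient.mk_surjective _ u
  obtain ⟨c, hc⟩ := Submodule.Quotient.mk_surjective _ (g (Submodule.Quotient.mk (1 : R)))
  refine ⟨c, ?_⟩
  have hb : (Submodule.Quotient.mk b : Q) = b • Submodule.Quotient.mk (1 : R) := by
    exact congrArg Submodule.Quotient.mk (mul_one b).symm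
  rw [← hgu]
  refine (congrArg g hb).trans ?_
  rw [map_smul, ← hc]
  exact congrArg Submodule.Quotient.mk (mul_comm b c)

section PolynomialRing

open TensorProduct

theorem hasProjectiveDimensionLT_baseChange {R B : Type u} [CommRing R] [CommRing B] [Algebra R B]
    [Module.Flat R B] (n : ℕ) : ∀ {M : Type u} [AddCommGroup M] [Module R M],
      HasProjectiveDimensionLT (ModuleCat.of R M) (n + 1) →
        HasProjectiveDimensionLT (ModuleCat.of B (B ⊗[R] M)) (n + 1) := by
  induction n with
  | zero =>
    intro M _ _ h
    have : Module.Projective R M :=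
      (IsProjective.iff_projective M).2 (projective_iff_hasProjectiveDimensionLT_one.2 h)
    exact projective_iff_hasProjectiveDimensionLT_one.1
      ((IsProjective.iff_projective (B ⊗[R] M)).1 inferInstance)
  | succ n ih =>
    intro M _ _ h
    let f : (M →₀ R) →ₗ[R] M := Finsupp.linearCombination R id
    have hf : Function.Surjective f := Finsupp.linearCombination_id_surjective R M
    have hS := LinearMap.shortExact_shortComplexKer hf
    have hker : Function.Exact (LinearMap.ker f).subtype f := LinearMap.exact_subtype_ker_map f
    have hlT := lTensor_exact (R := R) (M := LinearMap.ker f) (N := M →₀ R) (P := M)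
      (f := (LinearMap.ker f).subtype) (g := f) B hker hf
    have hex : Function.Exact ((LinearMap.ker f).subtype.baseChange B) (f.baseChange B) :=
      fun t => hlT t
    have hT : (ModuleCat.shortComplexOfCompEqZero _ _ hex.linearMap_comp_eq_zero).ShortExact :=
      ModuleCat.shortComplex_shortExact _ hex
        (Module.Flat.lTensor_preserves_injective_linearMap (M := B) _
          (LinearMap.ker f).subtype_injective) (LinearMap.lTensor_surjective B hf)
    have hP : Projective (ModuleCat.of R (M →₀ R)) :=
      (IsProjective.iff_projective (M →₀ R)).1 inferInstance
    have hP' : Projective (ModuleCat.of B (B ⊗[R] (M →₀ R))) :=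
      (IsProjective.iff_projective (B ⊗[R] (M →₀ R))).1 inferInstance
    exact (hT.hasProjectiveDimensionLT_X₃_iff n hP').2
      (ih ((hS.hasProjectiveDimensionLT_X₃_iff n hP).1 h))

section

variable {R : Type u} [CommRing R] {M : Type u} [AddCommGroup M] [Module R M]
  [Module (Polynomial R) M] [IsScalarTower R (Polynomial R) M]

variable (R M) in
/-- The action map `R[X] ⊗ M → M` of an `R[X]`-module. -/
def polynomialActionMap : Polynomial R ⊗[R] M →ₗ[Polynomial R] M :=
  (LinearMap.id : M →ₗ[R] M).liftBaseChange (Polynomial R)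

variable (R M) in
/-- The endomorphism `X ⊗ 1 - 1 ⊗ X` of `R[X] ⊗ M`. -/
def polynomialActionKernelMap : Polynomial R ⊗[R] M →ₗ[Polynomial R] Polynomial R ⊗[R] M :=
  (Polynomial.X : Polynomial R) • LinearMap.id -
    ((LinearMap.lsmul (Polynomial R) M Polynomial.X).restrictScalars R).baseChange (Polynomial R)

theorem polynomialActionMap_tmul (f : Polynomial R) (m : M) :
    polynomialActionMap R M (f ⊗ₜ m) = f • m := by
  simp [polynomialActionMap]

theorem polynomialActionKernelMap_tmul (f : Polynomial R) (m : M) :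
    polynomialActionKernelMap R M (f ⊗ₜ m) =
      (Polynomial.X * f) ⊗ₜ m - f ⊗ₜ ((Polynomial.X : Polynomial R) • m) := by
  simp [polynomialActionKernelMap, TensorProduct.smul_tmul']

theorem polynomialActionMap_comp_kernelMap :
    polynomialActionMap R M ∘ₗ polynomialActionKernelMap R M = 0 := by
  ext m
  simp [polynomialActionMap_tmul, polynomialActionKernelMap_tmul]

theorem X_pow_tmul_sub_mem_range (i : ℕ) : ∀ m : M,
    (Polynomial.X ^ i : Polynomial R) ⊗ₜ m - 1 ⊗ₜ ((Polynomial.X ^ i : Polynomial R) • m) ∈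
      LinearMap.range (polynomialActionKernelMap R M) := by
  induction i with
  | zero => intro m; simp
  | succ i ih =>
    intro m
    have h1 : (Polynomial.X ^ (i + 1) : Polynomial R) ⊗ₜ[R] m -
          1 ⊗ₜ ((Polynomial.X ^ (i + 1) : Polynomial R) • m) =
        polynomialActionKernelMap R M ((Polynomial.X ^ i : Polynomial R) ⊗ₜ m) +
          ((Polynomial.X ^ i : Polynomial R) ⊗ₜ ((Polynomial.X : Polynomial R) • m) -
          1 ⊗ₜ ((Polynomial.X ^ i : Polynomial R) • (Polynomial.X : Polynomial R) • m)) := by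
      rw [polynomialActionKernelMap_tmul, ← mul_smul, ← pow_succ, pow_succ']
      abel
    rw [h1]
    exact add_mem (LinearMap.mem_range_self _ _) (ih _)

theorem sub_tmul_polynomialActionMap_mem_range (t : Polynomial R ⊗[R] M) :
    t - 1 ⊗ₜ polynomialActionMap R M t ∈ LinearMap.range (polynomialActionKernelMap R M) := by
  induction t with
  | zero => simp
  | add s t hs ht =>
    rw [map_add, tmul_add, add_sub_add_comm]
    exact add_mem hs ht
  | tmul f m =>
    rw [polynomialActionMap_tmul]
    induction f using Polynomial.induction_on' with
    | add f g hf hg =>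
      rw [add_smul, tmul_add, add_tmul, add_sub_add_comm]
      exact add_mem hf hg
    | monomial i a =>
      have h1 : (Polynomial.monomial i a : Polynomial R) = a • (Polynomial.X ^ i) := by
        rw [← Polynomial.C_mul_X_pow_eq_monomial, Polynomial.smul_eq_C_mul]
      have h2 : (a • (Polynomial.X ^ i : Polynomial R)) • m =
          (Polynomial.X ^ i : Polynomial R) • a • m := by
        rw [smul_assoc, ← algebraMap_smul (Polynomial R) a m, smul_smul, mul_comm, mul_smul,
          algebraMap_smul]
      rw [h1, h2, smul_tmul]
      exact X_pow_tmul_sub_mem_range i (a • m)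

theorem polynomialActionMap_exact :
    Function.Exact (polynomialActionKernelMap R M) (polynomialActionMap R M) := by
  intro t
  refine ⟨fun ht => ?_, ?_⟩
  · have := sub_tmul_polynomialActionMap_mem_range t
    rwa [ht, tmul_zero, sub_zero] at this
  · rintro ⟨s, rfl⟩
    exact congr($polynomialActionMap_comp_kernelMap s)

theorem polynomialActionKernelMap_injective :
    Function.Injective (polynomialActionKernelMap R M) := by
  let e := PolynomialModule.polynomialTensorProductLEquivPolynomialModule R M
  have he (f : Polynomial R) (m : M) (j : ℕ) : (e (f ⊗ₜ m)).coeff j = f.coeff j • m := by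
    change (f • PolynomialModule.single R 0 m).coeff j = _
    rw [PolynomialModule.smul_single_apply]
    simp
  have hcoeff (t : Polynomial R ⊗[R] M) (i : ℕ) :
      (e (polynomialActionKernelMap R M t)).coeff (i + 1) +
        (Polynomial.X : Polynomial R) • (e t).coeff (i + 1) = (e t).coeff i := by
    induction t with
    | zero => simp
    | add s t hs ht =>
      simp only [map_add, PolynomialModule.coeff_add, Finsupp.add_apply, smul_add, ← hs, ← ht]
      abel
    | tmul f m =>
      have hsum : e (polynomialActionKernelMap R M (f ⊗ₜ m)) +
          e (f ⊗ₜ ((Polynomial.X : Polynomial R) • m)) = e ((Polynomial.X * f) ⊗ₜ m) := by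
        rw [polynomialActionKernelMap_tmul, ← map_add, sub_add_cancel]
      have := congr(($hsum).coeff (i + 1))
      rw [PolynomialModule.coeff_add, Finsupp.add_apply, he, he, Polynomial.coeff_X_mul] at this
      rw [he, he, ← this, ← algebraMap_smul (Polynomial R) (f.coeff (i + 1)) m, smul_smul, mul_comm,
        mul_smul, algebraMap_smul]
  rw [injective_iff_map_eq_zero]
  intro t ht
  have hstep (i : ℕ) (hi : (e t).coeff (i + 1) = 0) : (e t).coeff i = 0 := by
    rw [← hcoeff, ht, hi]
    simp
  obtain ⟨N, hN⟩ := (e t).coeff.support.exists_nat_subset_range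
  have hlarge (i : ℕ) (hi : N ≤ i) : (e t).coeff i = 0 := by
    by_contra h
    exact absurd (Finset.mem_range.1 (hN (Finsupp.mem_support_iff.2 h))) (by omega)
  have hzero (k : ℕ) : ∀ i, N ≤ i + k → (e t).coeff i = 0 := by
    induction k with
    | zero => exact hlarge
    | succ k ih => exact fun i hi => hstep i (ih (i + 1) (by omega))
  apply e.injective
  rw [map_zero]
  apply PolynomialModule.coeff_injective
  ext i
  exact hzero N i (by omega)

theorem hasProjectiveDimensionLT_of_polynomialAction {n : ℕ}
    (h : HasProjectiveDimensionLT (ModuleCat.of R M) (n + 1)) :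
    HasProjectiveDimensionLT (ModuleCat.of (Polynomial R) M) (n + 2) := by
  have hS : (ModuleCat.shortComplexOfCompEqZero _ _
      (polynomialActionMap_exact (R := R) (M := M)).linearMap_comp_eq_zero).ShortExact :=
    ModuleCat.shortComplex_shortExact _ polynomialActionMap_exact
      polynomialActionKernelMap_injective
      fun m => ⟨1 ⊗ₜ m, by simp [polynomialActionMap_tmul]⟩
  have h1 : HasProjectiveDimensionLT (ModuleCat.of (Polynomial R) (Polynomial R ⊗[R] M)) (n + 1) :=
    hasProjectiveDimensionLT_baseChange n h
  have h2 : HasProjectiveDimensionLT (ModuleCat.of (Polynomial R) (Polynomial R ⊗[R] M)) (n + 2) :=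
    hasProjectiveDimensionLT_of_ge _ (n + 1) _ (by omega)
  exact hS.hasProjectiveDimensionLT_X₃ (n + 1) h1 h2

end

/-- If every `R`-module has projective dimension at most `n`, then every `R[X]`-module has
projective dimension at most `n + 1`. -/
theorem hasProjectiveDimensionLT_polynomial {R : Type u} [CommRing R] {n : ℕ}
    (h : ∀ M : ModuleCat.{u} R, HasProjectiveDimensionLT M (n + 1))
    (M : ModuleCat.{u} (Polynomial R)) : HasProjectiveDimensionLT M (n + 2) := by
  let _ : Module R M := Module.compHom M (algebraMap R (Polynomial R))
  have : IsScalarTower R (Polynomial R) M := ⟨fun r f m => by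
    rw [Algebra.smul_def, mul_smul]; rfl⟩
  exact hasProjectiveDimensionLT_of_polynomialAction (h (ModuleCat.of R M))

attribute [local instance] RingHomInvPair.of_ringEquiv in
theorem hasProjectiveDimensionLT_of_ringEquiv {R R' : Type u} [CommRing R] [CommRing R']
    (e : R ≃+* R') {n : ℕ} (h : ∀ M : ModuleCat.{u} R, HasProjectiveDimensionLT M (n + 1))
    (M : ModuleCat.{u} R') : HasProjectiveDimensionLT M (n + 1) := by
  let _ : Module R M := Module.compHom M (e : R →+* R')
  let e' : ModuleCat.of R M ≃ₛₗ[RingHomClass.toRingHom e] M :=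
    { AddEquiv.refl M with map_smul' := fun _ _ => rfl }
  have := h (ModuleCat.of R M)
  exact ModuleCat.hasProjectiveDimensionLE_of_semiLinearEquiv e e' n

theorem hasProjectiveDimensionLT_mvPolynomial {F : Type u} [Field F] (n : ℕ) :
    ∀ M : ModuleCat.{u} (MvPolynomial (Fin n) F), HasProjectiveDimensionLT M (n + 1) := by
  induction n with
  | zero =>
    apply hasProjectiveDimensionLT_of_ringEquiv (isEmptyAlgEquiv F (Fin 0)).symm.toRingEquiv
    intro M
    have : Module.Projective F M := Module.Projective.of_free
    exact projective_iff_hasProjectiveDimensionLT_one.1 ((IsProjective.iff_projective M).1 this)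
  | succ n ih =>
    exact hasProjectiveDimensionLT_of_ringEquiv (finSuccEquiv F n).symm.toRingEquiv
      (hasProjectiveDimensionLT_polynomial ih)

theorem hasInjectiveDimensionLT_of_hasProjectiveDimensionLT {R : Type u} [CommRing R] {n : ℕ}
    (h : ∀ M : ModuleCat.{u} R, HasProjectiveDimensionLT M n) (M : ModuleCat.{u} R) :
    HasInjectiveDimensionLT M n :=
  .mk fun i hi N e => (HasProjectiveDimensionLT.subsingleton N n i hi M).elim e 0

end PolynomialRing

section Coextension

open Limits

variable {A R : Type u} [CommRing A] [CommRing R] [Algebra A R]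

variable (A R) in
/-- `R` regarded as an `A`-module by restriction of scalars is the `A`-module `R`. -/
def restrictScalarsSelfEquiv :
    (ModuleCat.restrictScalars (algebraMap A R)).obj (ModuleCat.of R R) ≃ₗ[A] R :=
  { AddEquiv.refl R with map_smul' := fun a r => (Algebra.smul_def (A := R) a r).symm }

theorem shortExact_map_coextendScalars [Module.Projective A R]
    {T : ShortComplex (ModuleCat.{u} A)} (hT : T.ShortExact) :
    (T.map (ModuleCat.coextendScalars.{u, u, u} (algebraMap A R))).ShortExact := by
  have : (ModuleCat.coextendScalars.{u, u, u} (algebraMap A R)).IsRightAdjoint :=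
    (ModuleCat.restrictCoextendScalarsAdj.{u} (algebraMap A R)).isRightAdjoint
  have := hT.mono_f
  have hsurj : Function.Surjective T.g := (ModuleCat.epi_iff_surjective _).1 hT.epi_g
  have hmono : Mono ((ModuleCat.coextendScalars.{u, u, u} (algebraMap A R)).map T.f) :=
    @Functor.map_mono _ _ _ _ _ (Functor.preservesMonomorphisms_of_adjunction
      (ModuleCat.restrictCoextendScalarsAdj.{u} (algebraMap A R))) _ _ _ hT.mono_f
  have hepi : Epi ((ModuleCat.coextendScalars.{u, u, u} (algebraMap A R)).map T.g) := by
    rw [ModuleCat.epi_iff_surjective]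
    intro y
    have : Module.Projective A
        ((ModuleCat.restrictScalars (algebraMap A R)).obj (ModuleCat.of R R)) :=
      Module.Projective.of_equiv (restrictScalarsSelfEquiv A R).symm
    obtain ⟨z, hz⟩ := Module.projective_lifting_property T.g.hom
      (ModuleCat.CoextendScalars.equiv _ _ y) hsurj
    refine ⟨(ModuleCat.CoextendScalars.equiv _ _).symm z, ?_⟩
    apply ModuleCat.CoextendScalars.ext
    ext s
    exact congr($hz s)
  exact { exact := hT.exact.map_of_mono_of_preservesKernel _ inferInstance inferInstance
          mono_f := hmono
          epi_g := hepi }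

theorem hasInjectiveDimensionLT_coextendScalars [Module.Projective A R] (n : ℕ) :
    ∀ M : ModuleCat.{u} A, HasInjectiveDimensionLT M (n + 1) → HasInjectiveDimensionLT
      ((ModuleCat.coextendScalars.{u, u, u} (algebraMap A R)).obj M) (n + 1) := by
  have hinj (I : ModuleCat.{u} A) (hI : Injective I) :
      Injective ((ModuleCat.coextendScalars.{u, u, u} (algebraMap A R)).obj I) :=
    Injective.injective_of_adjoint (ModuleCat.restrictCoextendScalarsAdj.{u} (algebraMap A R)) I
  induction n with
  | zero =>
    intro M h
    rw [zero_add, ← injective_iff_hasInjectiveDimensionLT_one] at h ⊢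
    exact hinj M h
  | succ n ih =>
    intro M h
    obtain ⟨I, hI, f, _⟩ := (inferInstance : EnoughInjectives (ModuleCat.{u} A)).1 M
    let T := ShortComplex.mk f (cokernel.π f) (cokernel.condition f)
    have hT : T.ShortExact := { exact := ShortComplex.exact_cokernel f }
    exact ((shortExact_map_coextendScalars hT).hasInjectiveDimensionLT_X₃_iff n (hinj I hI)).1
      (ih T.X₃ ((hT.hasInjectiveDimensionLT_X₃_iff n hI).2 h))

/-- If `R` is projective over `A` and there is an `A`-linear form on `R` inducing an isomorphism
`R ≃ Hom_A(R, A)`, then finiteness of the injective dimension passes from `A` to `R`. -/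
theorem hasInjectiveDimensionLT_of_linearForm [Module.Projective A R] {n : ℕ}
    (h : HasInjectiveDimensionLT (ModuleCat.of A A) (n + 1)) (φ : R →ₗ[A] A)
    (hφ : ∀ r, (∀ s, φ (s * r) = 0) → r = 0) (hφ' : ∀ g : R →ₗ[A] A, ∃ r, ∀ s, g s = φ (s * r)) :
    HasInjectiveDimensionLT (ModuleCat.of R R) (n + 1) := by
  have h1 : HasInjectiveDimensionLE _ n := hasInjectiveDimensionLT_coextendScalars (R := R) n _ h
  let E := ModuleCat.CoextendScalars.equiv (algebraMap A R) (ModuleCat.of A A)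
  let ι := restrictScalarsSelfEquiv A R
  have hE (r s : R) (x : (ModuleCat.coextendScalars.{u, u, u} (algebraMap A R)).obj (.of A A)) :
      E (r • x) s = E x (s * r : R) := rfl
  let ψ : R →ₗ[R] (ModuleCat.coextendScalars.{u, u, u} (algebraMap A R)).obj (.of A A) :=
    LinearMap.toSpanSingleton R _ (E.symm (φ ∘ₗ ι.toLinearMap))
  have hψ (r s : R) : E (ψ r) s = φ (s * r) := rfl
  have hbij : Function.Bijective ψ := by
    constructor
    · rw [injective_iff_map_eq_zero]
      intro r hr
      refine hφ r fun s => ?_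
      rw [← hψ, hr]
      rfl
    · intro x
      obtain ⟨r, hr⟩ := hφ' (E x ∘ₗ ι.symm.toLinearMap)
      refine ⟨r, E.injective ?_⟩
      ext s
      exact (hr s).symm
  exact (ModuleCat.hasInjectiveDimensionLE_iff_of_linearEquiv
    (M := ModuleCat.of R R) (LinearEquiv.ofBijective ψ hbij) n).2 h1

theorem isGorensteinRing_of_hasInjectiveDimensionLT [IsNoetherianRing R] {n : ℕ}
    (h : HasInjectiveDimensionLT (ModuleCat.of R R) (n + 1)) : IsGorensteinRing R := by
  refine ⟨inferInstance, fun P _ => ?_⟩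
  rw [hasFiniteInjectiveDimension_iff]
  have : HasInjectiveDimensionLE (ModuleCat.of R R) n := h
  refine ⟨n + 1, ?_⟩
  have h2 := ModuleCat.localizedModule_hasInjectiveDimensionLE n P.primeCompl (ModuleCat.of R R)
  have := ModuleCat.localizedModule_isLocalizedModule (ModuleCat.of R R) P.primeCompl
  let e : (ModuleCat.of R R).localizedModule P.primeCompl ≃ₗ[R] Localization.AtPrime P :=
    IsLocalizedModule.linearEquiv P.primeCompl
      ((ModuleCat.of R R).localizedModuleMkLinearMap P.primeCompl)
      (Algebra.linearMap R (Localization.AtPrime P))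
  exact (ModuleCat.hasInjectiveDimensionLE_iff_of_linearEquiv
    (LinearEquiv.extendScalarsOfIsLocalization P.primeCompl (Localization.AtPrime P) e) n).1 h2

end Coextension

section MonomialSubalgebra

variable {F : Type u} [Field F] {k : ℕ}

variable (F) in
/-- The span of the monomials with exponent in a submonoid `L`. -/
def monomialSubalgebra (L : AddSubmonoid (Fin k →₀ ℕ)) : Subalgebra F (MvPolynomial (Fin k) F) where
  carrier := {f | ∀ d ∈ f.support, d ∈ L}
  mul_mem' := fun {f g} hf hg d hd => by
    obtain ⟨a, ha, b, hb, rfl⟩ := Finset.mem_add.1 (support_mul f g hd)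
    exact add_mem (hf a ha) (hg b hb)
  add_mem' := fun {f g} hf hg d hd =>
    (Finset.mem_union.1 (support_add hd)).elim (hf d) (hg d)
  algebraMap_mem' := fun r d hd => by
    rw [algebraMap_eq, mem_support_iff, coeff_C] at hd
    rw [← (ite_ne_right_iff.1 hd).1]
    exact zero_mem L

theorem monomial_mem_monomialSubalgebra {L : AddSubmonoid (Fin k →₀ ℕ)} {d : Fin k →₀ ℕ}
    (hd : d ∈ L) (c : F) : monomial d c ∈ monomialSubalgebra F L := fun e he => by
  rwa [Finset.mem_singleton.1 (support_monomial_subset he)]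

/-- The exponent all of whose entries are `m - 1`. -/
def topExponent (k m : ℕ) : Fin k →₀ ℕ := Finsupp.equivFunOnFinite.symm fun _ => m - 1

/-- Entrywise quotient of an exponent by `m`. -/
def divExponent (m : ℕ) (d : Fin k →₀ ℕ) : Fin k →₀ ℕ := d.mapRange (· / m) (Nat.zero_div m)

/-- Entrywise remainder of an exponent modulo `m`. -/
def modExponent (m : ℕ) (d : Fin k →₀ ℕ) : Fin k →₀ ℕ := d.mapRange (· % m) (Nat.zero_mod m)

@[simp] theorem topExponent_apply (m : ℕ) (i : Fin k) : topExponent k m i = m - 1 := rfl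

@[simp] theorem divExponent_apply (m : ℕ) (d : Fin k →₀ ℕ) (i : Fin k) :
    divExponent m d i = d i / m := rfl

@[simp] theorem modExponent_apply (m : ℕ) (d : Fin k →₀ ℕ) (i : Fin k) :
    modExponent m d i = d i % m := rfl

theorem smul_divExponent_add_modExponent (m : ℕ) (d : Fin k →₀ ℕ) :
    m • divExponent m d + modExponent m d = d := by
  ext i
  simp [Nat.div_add_mod]

theorem modExponent_le_topExponent {m : ℕ} (hm : 0 < m) (d : Fin k →₀ ℕ) :
    modExponent m d ≤ topExponent k m := fun i => by
  have := Nat.mod_lt (d i) hm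
  simp
  omega

theorem modExponent_eq_self {m : ℕ} (hm : 0 < m) {d : Fin k →₀ ℕ} (hd : d ≤ topExponent k m) :
    modExponent m d = d := by
  ext i
  have := hd i
  simp at this
  exact Nat.mod_eq_of_lt (by omega)

theorem divExponent_eq_zero {m : ℕ} (hm : 0 < m) {d : Fin k →₀ ℕ} (hd : d ≤ topExponent k m) :
    divExponent m d = 0 := by
  ext i
  have := hd i
  simp at this
  exact Nat.div_eq_of_lt (by omega)

variable (F) in
/-- The coefficient of `X ^ b` of a polynomial regarded as an element of a free module over the
subring of polynomials in the `m`-th powers of the variables. -/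
def residueComponent (m : ℕ) (b : Fin k →₀ ℕ) :
    MvPolynomial (Fin k) F →ₗ[F] MvPolynomial (Fin k) F :=
  (basisMonomials (Fin k) F).constr F fun d =>
    if modExponent m d = b then monomial (divExponent m d) 1 else 0

theorem residueComponent_monomial (m : ℕ) (b d : Fin k →₀ ℕ) (c : F) :
    residueComponent F m b (monomial d c) =
      if modExponent m d = b then monomial (divExponent m d) c else 0 := by
  have h := (basisMonomials (Fin k) F).constr_basis F
    (fun d => if modExponent m d = b then monomial (divExponent m d) (1 : F) else 0) d
  rw [coe_basisMonomials] at h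
  rw [← mul_one c, ← smul_eq_mul, ← smul_monomial, map_smul, residueComponent, h]
  split_ifs <;> simp [smul_monomial]

theorem residueComponent_expand_mul {m : ℕ} (hm : 0 < m) (b : Fin k →₀ ℕ)
    (a f : MvPolynomial (Fin k) F) :
    residueComponent F m b (expand m a * f) = a * residueComponent F m b f := by
  induction a using MvPolynomial.induction_on' with
  | add a a' h h' => rw [map_add, add_mul, map_add, h, h', add_mul]
  | monomial e c =>
    induction f using MvPolynomial.induction_on' with
    | add f f' h h' => rw [mul_add, map_add, h, h', map_add, mul_add]
    | monomial d c' =>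
      have h1 : modExponent m (m • e + d) = modExponent m d := by
        ext i
        simp
      have h2 : divExponent m (m • e + d) = e + divExponent m d := by
        ext i
        simp [Nat.mul_add_div hm]
      rw [expand_monomial, monomial_mul, residueComponent_monomial, residueComponent_monomial,
        h1, h2, mul_ite, monomial_mul, mul_zero]

theorem sum_expand_residueComponent {m : ℕ} (hm : 0 < m) (f : MvPolynomial (Fin k) F) :
    ∑ b ∈ Finset.Iic (topExponent k m), expand m (residueComponent F m b f) * monomial b 1 = f := by
  induction f using MvPolynomial.induction_on' with
  | add f f' h h' =>
    conv_rhs => rw [← h, ← h', ← Finset.sum_add_distrib]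
    simp only [map_add, add_mul]
  | monomial d c =>
    rw [Finset.sum_eq_single (modExponent m d)]
    · rw [residueComponent_monomial, if_pos rfl, expand_monomial, monomial_mul, mul_one,
        smul_divExponent_add_modExponent]
    · intro b _ hb
      rw [residueComponent_monomial, if_neg hb.symm, map_zero, zero_mul]
    · intro h
      exact absurd (Finset.mem_Iic.2 (modExponent_le_topExponent hm d)) h

theorem residueComponent_topExponent_mul {m : ℕ} (hm : 0 < m) {b b' : Fin k →₀ ℕ}
    (hb : b + b' = topExponent k m) (f : MvPolynomial (Fin k) F) :
    residueComponent F m (topExponent k m) (monomial b' 1 * f) = residueComponent F m b f := by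
  induction f using MvPolynomial.induction_on' with
  | add f f' h h' => rw [mul_add, map_add, h, h', map_add]
  | monomial d c =>
    have hb' (i : Fin k) : b i + b' i = m - 1 := congr($hb i)
    rw [monomial_mul, one_mul, residueComponent_monomial, residueComponent_monomial]
    have hiff : modExponent m (b' + d) = topExponent k m ↔ modExponent m d = b := by
      simp only [Finsupp.ext_iff, modExponent_apply, topExponent_apply, Finsupp.add_apply]
      refine forall_congr' fun i => ?_
      have := hb' i
      have h1 := Nat.div_add_mod (d i) m
      have h2 := Nat.mod_lt (d i) hm
      constructor
      · intro h
        have h3 : b' i + d i = b' i + d i % m + m * (d i / m) := by omega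
        rw [h3, Nat.add_mul_mod_self_left] at h
        rcases lt_or_ge (b' i + d i % m) m with h4 | h4
        · rw [Nat.mod_eq_of_lt h4] at h
          omega
        · rw [Nat.mod_eq_sub_mod h4, Nat.mod_eq_of_lt (by omega)] at h
          omega
      · intro h
        have : b' i + d i = (m - 1) + m * (d i / m) := by omega
        rw [this, Nat.add_mul_mod_self_left, Nat.mod_eq_of_lt (by omega)]
    simp only [hiff]
    split_ifs with h
    · suffices divExponent m (b' + d) = divExponent m d by rw [this]
      ext i
      have h0 : d i % m = b i := congr($h i)
      have := hb' i
      have h1 := Nat.div_add_mod (d i) m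
      have : b' i + d i = (m - 1) + m * (d i / m) := by omega
      rw [divExponent_apply, Finsupp.add_apply, this, Nat.add_mul_div_left _ _ hm,
        Nat.div_eq_of_lt (by omega), zero_add, divExponent_apply]
    · rfl

end MonomialSubalgebra

section MonomialSubalgebraGorenstein

variable {F : Type u} [Field F] {k : ℕ} {L : AddSubmonoid (Fin k →₀ ℕ)} {m : ℕ}

theorem expand_mem_monomialSubalgebra (hmL : ∀ d, m • d ∈ L) (f : MvPolynomial (Fin k) F) :
    expand m f ∈ monomialSubalgebra F L := by
  induction f using MvPolynomial.induction_on' with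
  | add f g hf hg => rw [map_add]; exact add_mem hf hg
  | monomial d c =>
    rw [expand_monomial]
    exact monomial_mem_monomialSubalgebra (hmL d) c

theorem modExponent_mem_iff (hL : ∀ d e, d ∈ L → d + e ∈ L → e ∈ L) (hmL : ∀ d, m • d ∈ L)
    (d : Fin k →₀ ℕ) : modExponent m d ∈ L ↔ d ∈ L := by
  constructor
  · intro h
    rw [← smul_divExponent_add_modExponent m d]
    exact add_mem (hmL _) h
  · intro h
    exact hL (m • divExponent m d) _ (hmL _) (by rwa [smul_divExponent_add_modExponent])

theorem residueComponent_eq_zero (hL : ∀ d e, d ∈ L → d + e ∈ L → e ∈ L) (hmL : ∀ d, m • d ∈ L)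
    {b : Fin k →₀ ℕ} (hb : b ∉ L) {f : MvPolynomial (Fin k) F}
    (hf : f ∈ monomialSubalgebra F L) : residueComponent F m b f = 0 := by
  rw [f.as_sum, map_sum]
  refine Finset.sum_eq_zero fun d hd => ?_
  rw [residueComponent_monomial, if_neg]
  rintro rfl
  exact hb ((modExponent_mem_iff hL hmL d).2 (hf d hd))

open scoped Classical in
variable (F L) in
/-- The monomial with exponent `b` as an element of the subalgebra, or `0` if `b ∉ L`. -/
def subMonomial (b : Fin k →₀ ℕ) : monomialSubalgebra F L :=
  if hb : b ∈ L then ⟨monomial b 1, monomial_mem_monomialSubalgebra hb 1⟩ else 0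

theorem coe_subMonomial {b : Fin k →₀ ℕ} (hb : b ∈ L) :
    (subMonomial F L b : MvPolynomial (Fin k) F) = monomial b 1 := by
  rw [subMonomial, dif_pos hb]

theorem isGorensteinRing_monomialSubalgebra (hm : 0 < m)
    (hL : ∀ d e, d ∈ L → d + e ∈ L → e ∈ L) (hmL : ∀ d, m • d ∈ L) (hJ : topExponent k m ∈ L) :
    IsGorensteinRing (monomialSubalgebra F L) := by
  let _ : Algebra (MvPolynomial (Fin k) F) (monomialSubalgebra F L) :=
    ((expand m : MvPolynomial (Fin k) F →ₐ[F] _).codRestrict (monomialSubalgebra F L)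
      (expand_mem_monomialSubalgebra hmL)).toRingHom.toAlgebra
  have hsmul (a : MvPolynomial (Fin k) F) (f : monomialSubalgebra F L) :
      ((a • f : monomialSubalgebra F L) : MvPolynomial (Fin k) F) = expand m a * f := rfl
  let ρ (b : Fin k →₀ ℕ) : monomialSubalgebra F L →ₗ[MvPolynomial (Fin k) F]
      MvPolynomial (Fin k) F :=
    { toFun := fun f => residueComponent F m b f
      map_add' := fun f g => map_add (residueComponent F m b) _ _
      map_smul' := fun a f => residueComponent_expand_mul hm b a f }
  have hρ (b : Fin k →₀ ℕ) (f : monomialSubalgebra F L) : ρ b f = residueComponent F m b f := rfl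
  let I := Finset.Iic (topExponent k m)
  have hsum (f : monomialSubalgebra F L) : ∑ b ∈ I, ρ b f • subMonomial F L b = f := by
    apply Subtype.ext
    rw [AddSubmonoidClass.coe_finsetSum]
    conv_rhs => rw [← sum_expand_residueComponent hm (f : MvPolynomial (Fin k) F)]
    refine Finset.sum_congr rfl fun b _ => ?_
    rw [hsmul, hρ]
    by_cases hb : b ∈ L
    · rw [coe_subMonomial hb]
    · rw [residueComponent_eq_zero hL hmL hb f.2, map_zero, zero_mul, zero_mul]
  let i : monomialSubalgebra F L →ₗ[MvPolynomial (Fin k) F] (I → MvPolynomial (Fin k) F) :=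
    LinearMap.pi fun b => ρ b
  let s : (I → MvPolynomial (Fin k) F) →ₗ[MvPolynomial (Fin k) F] monomialSubalgebra F L :=
    Fintype.linearCombination _ fun b : I => subMonomial F L b
  have hsi : s ∘ₗ i = LinearMap.id := by
    ext1 f
    rw [LinearMap.id_apply, ← hsum f]
    conv_rhs => rw [← Finset.sum_coe_sort]
    rw [hsum f]
    rfl
  have hproj : Module.Projective (MvPolynomial (Fin k) F) (monomialSubalgebra F L) :=
    Module.Projective.of_split i s hsi
  have hfin : Module.Finite (MvPolynomial (Fin k) F) (monomialSubalgebra F L) :=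
    Module.Finite.of_surjective s fun f => ⟨i f, congr($hsi f)⟩
  have hnoeth : IsNoetherianRing (monomialSubalgebra F L) :=
    IsNoetherianRing.of_finite (MvPolynomial (Fin k) F) _
  have hinj := hasInjectiveDimensionLT_of_hasProjectiveDimensionLT
    (hasProjectiveDimensionLT_mvPolynomial (F := F) k) (ModuleCat.of _ (MvPolynomial (Fin k) F))
  have hcompl {b : Fin k →₀ ℕ} (hb : b ∈ I) : b + (topExponent k m - b) = topExponent k m :=
    add_tsub_cancel_of_le (Finset.mem_Iic.1 hb)
  have hcomplL {b : Fin k →₀ ℕ} (hb : b ∈ I) (hbL : b ∈ L) : topExponent k m - b ∈ L :=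
    hL b _ hbL (by rwa [hcompl hb])
  have hφ {b : Fin k →₀ ℕ} (hb : b ∈ I) (hbL : b ∈ L) (f : monomialSubalgebra F L) :
      ρ (topExponent k m) (subMonomial F L (topExponent k m - b) * f) = ρ b f := by
    rw [hρ, hρ, MulMemClass.coe_mul, coe_subMonomial (hcomplL hb hbL),
      residueComponent_topExponent_mul hm (hcompl hb)]
  refine isGorensteinRing_of_hasInjectiveDimensionLT
    (hasInjectiveDimensionLT_of_linearForm hinj (ρ (topExponent k m)) ?_ ?_)
  · intro f hf
    rw [← hsum f]
    refine Finset.sum_eq_zero fun b hb => ?_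
    by_cases hbL : b ∈ L
    · rw [← hφ hb hbL, hf, zero_smul]
    · rw [hρ, residueComponent_eq_zero hL hmL hbL f.2, zero_smul]
  · intro g
    let r := ∑ b ∈ I, g (subMonomial F L (topExponent k m - b)) • subMonomial F L b
    refine ⟨r, fun t => ?_⟩
    have hzero {b : Fin k →₀ ℕ} (hb : b ∉ L) : subMonomial F L b = 0 := dif_neg hb
    have hcase {b : Fin k →₀ ℕ} (hb : b ∈ I) (hbL : b ∈ L) :
        g (subMonomial F L b) = ρ (topExponent k m) (subMonomial F L b * r) := by
      have hb' : topExponent k m - b ∈ I := Finset.mem_Iic.2 tsub_le_self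
      have hbb : topExponent k m - (topExponent k m - b) = b :=
        tsub_tsub_cancel_of_le (Finset.mem_Iic.1 hb)
      have h1 := hφ hb' (hcomplL hb hbL) r
      rw [hbb] at h1
      rw [h1, map_sum, Finset.sum_eq_single (topExponent k m - b)]
      · rw [map_smul, hρ, coe_subMonomial (hcomplL hb hbL), residueComponent_monomial,
          modExponent_eq_self hm tsub_le_self, if_pos rfl, divExponent_eq_zero hm tsub_le_self, hbb,
          smul_eq_mul, ← C_apply, C_1, mul_one]
      · intro c hc hcb
        rw [map_smul, hρ]
        by_cases hcL : c ∈ L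
        · rw [coe_subMonomial hcL, residueComponent_monomial,
            modExponent_eq_self hm (Finset.mem_Iic.1 hc), if_neg hcb, smul_zero]
        · rw [hzero hcL, ZeroMemClass.coe_zero, map_zero, smul_zero]
      · exact fun h => absurd hb' h
    rw [← hsum t, map_sum, Finset.sum_mul, map_sum]
    refine Finset.sum_congr rfl fun b hb => ?_
    rw [map_smul, smul_mul_assoc, map_smul]
    by_cases hbL : b ∈ L
    · rw [hcase hb hbL]
    · rw [hzero hbL, zero_mul, map_zero, map_zero]

end MonomialSubalgebraGorenstein

section LocalSocle

theorem isFiniteLength_quotient_of_maximalIdeal_le_radical {B : Type u} [CommRing B]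
    [IsNoetherianRing B] [IsLocalRing B] {I : Ideal B} (hI : I ≤ IsLocalRing.maximalIdeal B)
    (hrad : IsLocalRing.maximalIdeal B ≤ I.radical) : IsFiniteLength B (B ⧸ I) := by
  have : IsArtinianRing (B ⧸ I) :=
    IsLocalRing.quotient_artinian_of_mem_minimalPrimes_of_isLocalRing I
      ⟨⟨(IsLocalRing.maximalIdeal.isMaximal B).isPrime, hI⟩, fun Q hQ _ =>
        hrad.trans (hQ.1.radical_le_iff.2 hQ.2)⟩
  have : IsArtinian B (B ⧸ I) :=
    isArtinian_of_surjective_algebraMap (R := B ⧸ I) Ideal.Quotient.mk_surjective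
  exact isFiniteLength_iff_isNoetherian_isArtinian.2 ⟨inferInstance, this⟩

/-- In a Gorenstein ring, two socle elements modulo a regular sequence of parameters of a
localization are proportional locally. -/
theorem exists_mul_sub_mul_mem_of_isGorensteinRing {R : Type u} [CommRing R]
    (hR : IsGorensteinRing R) (P : Ideal R) [P.IsPrime] {rs : List R}
    (hreg : RingTheory.Sequence.IsWeaklyRegular R rs) (hrs : ∀ r ∈ rs, r ∈ P)
    (hrad : P ≤ (Ideal.ofList rs).radical) {u v : R} (hu : ∀ t ∉ P, t * u ∉ Ideal.ofList rs)
    (hPu : ∀ r ∈ P, r * u ∈ Ideal.ofList rs) (hPv : ∀ r ∈ P, r * v ∈ Ideal.ofList rs) :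
    ∃ s ∉ P, ∃ c, s * v - c * u ∈ Ideal.ofList rs := by
  have := hR.1
  let B := Localization.AtPrime P
  obtain ⟨N, hN⟩ := (hasFiniteInjectiveDimension_iff _).1 (hR.2 P)
  have hregB := hreg.isRegular_of_isLocalization_of_mem B P hrs
  have hmap : Ideal.ofList (rs.map (algebraMap R B)) = (Ideal.ofList rs).map (algebraMap R B) :=
    (Ideal.map_ofList _ _).symm
  have htop : (Ideal.ofList (rs.map (algebraMap R B)) • ⊤ : Submodule B B) =
      (Ideal.ofList rs).map (algebraMap R B) := by
    rw [smul_eq_mul, Ideal.mul_top, hmap]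
  have hmax : P.map (algebraMap R B) = IsLocalRing.maximalIdeal B :=
    IsLocalization.AtPrime.map_eq_maximalIdeal P B
  have hfl : IsFiniteLength B (B ⧸ (Ideal.ofList (rs.map (algebraMap R B)) • ⊤ :
      Submodule B B)) := by
    rw [htop]
    refine isFiniteLength_quotient_of_maximalIdeal_le_radical ?_ ?_
    · rw [← hmax]
      exact Ideal.map_mono (Ideal.span_le.2 hrs)
    · rw [← hmax]
      exact (Ideal.map_mono hrad).trans (Ideal.map_radical_le _)
  have hsocle (x : R) (hx : ∀ r ∈ P, r * x ∈ Ideal.ofList rs) :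
      ∀ r ∈ IsLocalRing.maximalIdeal B, r • (Submodule.Quotient.mk (algebraMap R B x) :
        B ⧸ (Ideal.ofList (rs.map (algebraMap R B)) • ⊤ : Submodule B B)) = 0 := by
    intro r hr
    rw [← Submodule.Quotient.mk_smul, Submodule.Quotient.mk_eq_zero, htop, smul_eq_mul]
    rw [← hmax] at hr
    have hle : P.map (algebraMap R B) ≤
        ((Ideal.ofList rs).map (algebraMap R B)).colon {algebraMap R B x} :=
      Ideal.map_le_iff_le_comap.2 fun r hr => by
        rw [Ideal.mem_comap, Submodule.mem_colon_singleton, smul_eq_mul, ← map_mul]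
        exact Ideal.mem_map_of_mem _ (hx r hr)
    simpa [Submodule.mem_colon_singleton] using hle hr
  obtain ⟨r, hr⟩ := exists_smul_eq_of_isRegular hN _ hregB hfl
    (Submodule.Quotient.mk (algebraMap R B u)) (Submodule.Quotient.mk (algebraMap R B v))
    (by
      rw [Ne, Submodule.Quotient.mk_eq_zero, htop,
        IsLocalization.algebraMap_mem_map_algebraMap_iff P.primeCompl]
      rintro ⟨t, ht, htu⟩
      exact hu t ht htu)
    (hsocle u hPu) (hsocle v hPv)
  obtain ⟨c, s, rfl⟩ := IsLocalization.exists_mk'_eq P.primeCompl r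
  rw [← Submodule.Quotient.mk_smul, Submodule.Quotient.eq, htop, smul_eq_mul] at hr
  have h2 := Ideal.mul_mem_left _ (algebraMap R B s) hr
  rw [mul_sub, ← mul_assoc, IsLocalization.mk'_spec', ← map_mul, ← map_mul, ← map_sub,
    IsLocalization.algebraMap_mem_map_algebraMap_iff P.primeCompl] at h2
  obtain ⟨t, ht, h3⟩ := h2
  refine ⟨t * s, P.primeCompl.mul_mem ht s.2, t * c, ?_⟩
  rwa [mul_sub, ← mul_assoc, ← mul_assoc] at h3

end LocalSocle

section MonomialSubalgebraSocle

variable {F : Type u} [Field F] {k : ℕ} {L : AddSubmonoid (Fin k →₀ ℕ)} {m : ℕ}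

variable (F L m) in
/-- The `m`-th power of the variable `X i` as an element of the monomial subalgebra. -/
def subPower (i : Fin k) : monomialSubalgebra F L := subMonomial F L (Finsupp.single i m)

theorem single_mem_of_smul_mem (hmL : ∀ d, m • d ∈ L) (i : Fin k) : Finsupp.single i m ∈ L := by
  simpa using hmL (Finsupp.single i 1)

theorem sum_coeff_smul_subMonomial (f : monomialSubalgebra F L) :
    ∑ d ∈ (f : MvPolynomial (Fin k) F).support,
      coeff d (f : MvPolynomial (Fin k) F) • subMonomial F L d = f := by
  apply Subtype.ext
  rw [AddSubmonoidClass.coe_finsetSum]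
  conv_rhs => rw [(f : MvPolynomial (Fin k) F).as_sum]
  refine Finset.sum_congr rfl fun d hd => ?_
  rw [SetLike.val_smul, coe_subMonomial (f.2 d hd), smul_monomial, smul_eq_mul, mul_one]

theorem mem_span_subPower_iff (hL : ∀ d e, d ∈ L → d + e ∈ L → e ∈ L) (hmL : ∀ d, m • d ∈ L)
    (s : Set (Fin k)) (f : monomialSubalgebra F L) :
    f ∈ Ideal.span (subPower F L m '' s) ↔
      ∀ d ∈ (f : MvPolynomial (Fin k) F).support, ∃ i ∈ s, m ≤ d i := by
  constructor
  · intro hf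
    induction hf using Submodule.span_induction with
    | mem x hx =>
      obtain ⟨i, hi, rfl⟩ := hx
      intro d hd
      rw [subPower, coe_subMonomial (single_mem_of_smul_mem hmL i)] at hd
      rw [Finset.mem_singleton.1 (support_monomial_subset hd)]
      exact ⟨i, hi, by simp⟩
    | zero => simp
    | add x y _ _ hx hy =>
      intro d hd
      exact (Finset.mem_union.1 (support_add hd)).elim (hx d) (hy d)
    | smul a x _ hx =>
      intro d hd
      obtain ⟨b, _, e, he, rfl⟩ := Finset.mem_add.1 (support_mul _ _ hd)
      obtain ⟨i, hi, h⟩ := hx e he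
      exact ⟨i, hi, h.trans (by simp)⟩
  · intro hf
    rw [← sum_coeff_smul_subMonomial f]
    refine sum_mem fun d hd => ?_
    obtain ⟨i, hi, h⟩ := hf d hd
    have hd' : Finsupp.single i m + (d - Finsupp.single i m) = d :=
      add_tsub_cancel_of_le (by simpa using h)
    have hdL : d - Finsupp.single i m ∈ L :=
      hL _ _ (single_mem_of_smul_mem hmL i) (by rw [hd']; exact f.2 d hd)
    have : subMonomial F L d = subMonomial F L (d - Finsupp.single i m) * subPower F L m i := by
      apply Subtype.ext
      rw [MulMemClass.coe_mul, subPower, coe_subMonomial (f.2 d hd), coe_subMonomial hdL,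
        coe_subMonomial (single_mem_of_smul_mem hmL i), monomial_mul, add_comm, hd', one_mul]
    rw [this]
    exact Submodule.smul_of_tower_mem _ _
      (Ideal.mul_mem_left _ _ (Ideal.subset_span ⟨i, hi, rfl⟩))

theorem ofList_subPower_eq_span :
    Ideal.ofList (List.ofFn (subPower F L m)) = Ideal.span (subPower F L m '' Set.univ) := by
  rw [Ideal.ofList]
  congr 1
  ext r
  simp

theorem isWeaklyRegular_subPower (hL : ∀ d e, d ∈ L → d + e ∈ L → e ∈ L)
    (hmL : ∀ d, m • d ∈ L) :
    RingTheory.Sequence.IsWeaklyRegular (monomialSubalgebra F L)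
      (List.ofFn (subPower F L m)) := by
  rw [RingTheory.Sequence.isWeaklyRegular_iff]
  intro n hn
  have hn' : n < k := by simpa using hn
  have hspan : Ideal.ofList ((List.ofFn (subPower F L m)).take n) =
      Ideal.span (subPower F L m '' {i | i.1 < n}) := by
    rw [Ideal.ofList]
    congr 1
    ext r
    simp only [List.mem_take_iff_getElem, Set.mem_ofPred_eq, Set.mem_image]
    constructor
    · rintro ⟨j, hj, rfl⟩
      simp only [List.length_ofFn, lt_inf_iff] at hj
      exact ⟨⟨j, hj.2⟩, hj.1, by simp⟩
    · rintro ⟨i, hi, rfl⟩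
      exact ⟨i, by simp [hi], by simp⟩
  rw [isSMulRegular_quotient_iff_mem_of_smul_mem, smul_eq_mul, Ideal.mul_top, hspan]
  intro f hf
  rw [List.getElem_ofFn, smul_eq_mul] at hf
  rw [mem_span_subPower_iff hL hmL] at hf ⊢
  intro d hd
  rw [MulMemClass.coe_mul, subPower, coe_subMonomial (single_mem_of_smul_mem hmL _)] at hf
  obtain ⟨i, hi, h⟩ := hf (Finsupp.single ⟨n, hn'⟩ m + d) (by
    rw [mem_support_iff] at hd ⊢
    rwa [coeff_monomial_mul, one_mul])
  refine ⟨i, hi, ?_⟩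
  rwa [Finsupp.add_apply, Finsupp.single_eq_of_ne (by rintro rfl; exact lt_irrefl n hi),
    zero_add] at h

/-- If a monomial ring of finite index is Gorenstein, and all coordinates of the box of exponents
are attained, then its socle monomial is the top corner of the box. -/
theorem topExponent_mem_of_isGorensteinRing (hm : 0 < m)
    (hL : ∀ d e, d ∈ L → d + e ∈ L → e ∈ L) (hmL : ∀ d, m • d ∈ L)
    (hmax : ∀ i, ∃ d ∈ L, d ≤ topExponent k m ∧ d i = m - 1)
    (hG : IsGorensteinRing (monomialSubalgebra F L)) : topExponent k m ∈ L := by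
  classical
  let ε : monomialSubalgebra F L →+* F := constantCoeff.comp (monomialSubalgebra F L).val.toRingHom
  have hε (f : monomialSubalgebra F L) : ε f = coeff 0 (f : MvPolynomial (Fin k) F) := rfl
  have : (RingHom.ker ε).IsPrime := RingHom.ker_isPrime ε
  let B := (Finset.Iic (topExponent k m)).filter (· ∈ L)
  have hB {d : Fin k →₀ ℕ} : d ∈ B ↔ d ≤ topExponent k m ∧ d ∈ L := by simp [B]
  have hbox {d : Fin k →₀ ℕ} : d ≤ topExponent k m ↔ ¬ ∃ i ∈ Set.univ, m ≤ d i := by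
    simp only [Set.mem_univ, true_and, not_exists, not_le, Finsupp.le_def, topExponent_apply]
    exact forall_congr' fun i => by omega
  have hcomb {J J' : Fin k →₀ ℕ} (hJ : Maximal (· ∈ B) J) (hJ' : Maximal (· ∈ B) J') :
      J = J' := by
    by_contra hne
    have hsub {J : Fin k →₀ ℕ} (hJ : Maximal (· ∈ B) J) :=
      coe_subMonomial (F := F) (hB.1 hJ.prop).2
    have hsocle {J : Fin k →₀ ℕ} (hJ : Maximal (· ∈ B) J) :
        ∀ r ∈ RingHom.ker ε, r * subMonomial F L J ∈
          Ideal.ofList (List.ofFn (subPower F L m)) := by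
      intro r hr
      rw [ofList_subPower_eq_span, mem_span_subPower_iff hL hmL]
      intro d hd
      rw [MulMemClass.coe_mul, hsub hJ] at hd
      obtain ⟨e, he, b, hb, rfl⟩ := Finset.mem_add.1 (support_mul _ _ hd)
      obtain rfl := Finset.mem_singleton.1 (support_monomial_subset hb)
      by_contra hcon
      have h1 : e + b ∈ B := hB.2 ⟨hbox.2 hcon, add_mem (r.2 e he) (hB.1 hJ.prop).2⟩
      have h2 : e + b = b := (hJ.eq_of_le h1 le_add_self).symm
      rw [add_eq_right] at h2
      rw [h2, mem_support_iff] at he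
      exact he hr
    obtain ⟨s, hs, c, hsc⟩ := exists_mul_sub_mul_mem_of_isGorensteinRing hG (RingHom.ker ε)
      (isWeaklyRegular_subPower hL hmL) (u := subMonomial F L J) (v := subMonomial F L J')
      (by
        intro r hr
        obtain ⟨i, rfl⟩ := List.mem_ofFn.1 hr
        rw [RingHom.mem_ker, hε, subPower, coe_subMonomial (single_mem_of_smul_mem hmL i),
          coeff_monomial, if_neg]
        simpa using hm.ne')
      (by
        intro f hf
        rw [← sum_coeff_smul_subMonomial f]
        refine sum_mem fun d hd => Submodule.smul_of_tower_mem _ _ ⟨m, ?_⟩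
        rw [ofList_subPower_eq_span, mem_span_subPower_iff hL hmL]
        intro e he
        rw [SubmonoidClass.coe_pow, coe_subMonomial (f.2 d hd), monomial_pow] at he
        obtain rfl := Finset.mem_singleton.1 (support_monomial_subset he)
        have hd0 : d ≠ 0 := by
          rintro rfl
          exact mem_support_iff.1 hd hf
        obtain ⟨i, hi⟩ := Finsupp.ne_iff.1 hd0
        exact ⟨i, trivial, by simpa using Nat.le_mul_of_pos_right m (Nat.pos_of_ne_zero hi)⟩)
      (by
        intro t ht hmem
        rw [ofList_subPower_eq_span, mem_span_subPower_iff hL hmL] at hmem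
        refine hbox.1 (hB.1 hJ.prop).1 (hmem J ?_)
        rw [MulMemClass.coe_mul, hsub hJ, mem_support_iff, coeff_mul_monomial', if_pos le_rfl,
          tsub_self, mul_one]
        exact ht)
      (hsocle hJ) (hsocle hJ')
    rw [ofList_subPower_eq_span, mem_span_subPower_iff hL hmL] at hsc
    refine hbox.1 (hB.1 hJ'.prop).1 (hsc J' ?_)
    rw [AddSubgroupClass.coe_sub, MulMemClass.coe_mul, MulMemClass.coe_mul, hsub hJ, hsub hJ',
      mem_support_iff, coeff_sub, coeff_mul_monomial', coeff_mul_monomial', if_pos le_rfl,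
      tsub_self, mul_one, if_neg fun h => hne (hJ.eq_of_le hJ'.prop h), sub_zero]
    exact hs
  obtain ⟨J, -, hJ⟩ := B.exists_le_maximal (hB.2 ⟨zero_le, zero_mem L⟩)
  have hJtop : J = topExponent k m := by
    ext i
    obtain ⟨d, hd, hdm, hdi⟩ := hmax i
    obtain ⟨J', hdJ, hJ'⟩ := B.exists_le_maximal (hB.2 ⟨hdm, hd⟩)
    rw [← hcomb hJ hJ'] at hdJ
    have h1 := hdJ i
    have h2 := (hB.1 hJ.prop).1 i
    rw [topExponent_apply] at h2 ⊢
    omega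
  exact hJtop ▸ (hB.1 hJ.prop).2

end MonomialSubalgebraSocle

section Characters

variable {F : Type u} [Field F] {k : ℕ} {Γ : Type*} [Group Γ] (χ : Fin k → Γ →* F)

/-- The exponents of the monomials fixed by a diagonal action with characters `χ i`. -/
def invariantExponents : AddSubmonoid (Fin k →₀ ℕ) where
  carrier := {d | ∏ i, χ i ^ d i = 1}
  zero_mem' := by simp
  add_mem' := fun {d e} hd he => by
    simp only [Set.mem_ofPred_eq, Finsupp.add_apply, pow_add, Finset.prod_mul_distrib] at *
    rw [hd, he, one_mul]

variable {χ}

theorem MonoidHom.pow_natCard (ψ : Γ →* F) : ψ ^ Nat.card Γ = 1 := by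
  ext c
  rw [MonoidHom.pow_apply, ← map_pow, pow_card_eq_one', map_one, MonoidHom.one_apply]

theorem mem_invariantExponents {d : Fin k →₀ ℕ} :
    d ∈ invariantExponents χ ↔ ∏ i, χ i ^ d i = 1 := Iff.rfl

theorem mem_invariantExponents_of_add_mem {d e : Fin k →₀ ℕ} (hd : d ∈ invariantExponents χ)
    (hde : d + e ∈ invariantExponents χ) : e ∈ invariantExponents χ := by
  rw [mem_invariantExponents] at *
  simp only [Finsupp.add_apply, pow_add, Finset.prod_mul_distrib] at hde
  rwa [hd, one_mul] at hde

theorem card_smul_mem_invariantExponents (d : Fin k →₀ ℕ) :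
    Nat.card Γ • d ∈ invariantExponents χ := by
  rw [mem_invariantExponents]
  exact Finset.prod_eq_one fun i _ => by
    rw [Finsupp.smul_apply, smul_eq_mul, pow_mul, MonoidHom.pow_natCard, one_pow]

variable [Finite Γ]

/-- If characters of `Γ` other than `χ i` separate `1` from the other elements of `Γ`, then
`χ i` is a product of them. -/
theorem exists_mem_invariantExponents (i : Fin k) (hi : ∀ c, (∀ j ≠ i, χ j c = 1) → c = 1) :
    ∃ d ∈ invariantExponents χ, d ≤ topExponent k (Nat.card Γ) ∧ d i = Nat.card Γ - 1 := by
  classical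
  have := Fintype.ofFinite Γ
  let ψ : Fin k → Γ →* F := Function.update χ i 1
  have hψ (j : Fin k) (hj : j ≠ i) : ψ j = χ j := Function.update_of_ne hj ..
  obtain ⟨d, hd⟩ : ∃ d : Fin k →₀ ℕ, χ i ^ (Nat.card Γ - 1) * ∏ j, ψ j ^ d j = 1 := by
    by_contra! hne
    have hsep (c : Γ) : ∃ j, c ≠ 1 → ψ j c ≠ 1 := by
      by_cases hc : c = 1
      · exact ⟨i, fun h => absurd hc h⟩
      · obtain ⟨j, hj⟩ := not_forall.1 (mt (hi c) hc)
        obtain ⟨hj, h⟩ := Classical.not_imp.1 hj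
        exact ⟨j, fun _ => by rwa [hψ j hj]⟩
    choose j hj using hsep
    let f : MvPolynomial (Fin k) F := ∏ c ∈ Finset.univ.erase (1 : Γ), (X (j c) - C (ψ (j c) c))
    have hf (c : Γ) (hc : c ≠ 1) : eval (fun l => ψ l c) f = 0 := by
      rw [map_prod]
      exact Finset.prod_eq_zero (Finset.mem_erase.2 ⟨hc, Finset.mem_univ c⟩) (by simp)
    have hf1 : eval (fun l => ψ l 1) f ≠ 0 := by
      rw [map_prod, Finset.prod_ne_zero_iff]
      intro c hc
      simp only [map_one, map_sub, eval_X, eval_C]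
      exact sub_ne_zero.2 (hj c (Finset.ne_of_mem_erase hc)).symm
    apply hf1
    calc eval (fun l => ψ l 1) f
        = ∑ c, (χ i ^ (Nat.card Γ - 1)) c * eval (fun l => ψ l c) f := by
          rw [Finset.sum_eq_single 1 (fun c _ hc => by rw [hf c hc, mul_zero]) (by simp), map_one,
            one_mul]
      _ = ∑ c, ∑ d ∈ f.support, coeff d f * (χ i ^ (Nat.card Γ - 1) * ∏ j, ψ j ^ d j) c := by
          refine Finset.sum_congr rfl fun c _ => ?_
          rw [eval_eq', Finset.mul_sum]
          refine Finset.sum_congr rfl fun d _ => ?_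
          rw [MonoidHom.mul_apply, MonoidHom.finsetProd_apply]
          simp only [MonoidHom.pow_apply]
          ring
      _ = 0 := by
          rw [Finset.sum_comm]
          refine Finset.sum_eq_zero fun d _ => ?_
          rw [← Finset.mul_sum, sum_hom_units_eq_zero _ (hne d), mul_zero]
  have hm : 0 < Nat.card Γ := Nat.card_pos
  let e := d.update i (Nat.card Γ - 1)
  have he : e ∈ invariantExponents χ := by
    rw [mem_invariantExponents, ← hd, ← Finset.mul_prod_erase _ _ (Finset.mem_univ i),
      ← Finset.mul_prod_erase Finset.univ (fun j => ψ j ^ d j) (Finset.mem_univ i)]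
    congr 1
    · simp [e]
    · rw [show ψ i = 1 from Function.update_self .., one_pow, one_mul]
      refine Finset.prod_congr rfl fun j hj => ?_
      have hj := Finset.ne_of_mem_erase hj
      simp [e, ψ, hj]
  refine ⟨modExponent (Nat.card Γ) e, ?_, modExponent_le_topExponent hm e, ?_⟩
  · rwa [modExponent_mem_iff (fun _ _ => mem_invariantExponents_of_add_mem)
      card_smul_mem_invariantExponents]
  · simp [e]

/-- For a diagonal action without reflections, the ring spanned by the invariant monomials is
Gorenstein if and only if the product of the characters is trivial. -/
theorem isGorensteinRing_invariantExponents_iff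
    (hχ : ∀ i c, (∀ j ≠ i, χ j c = 1) → c = 1) :
    IsGorensteinRing (monomialSubalgebra F (invariantExponents χ)) ↔ ∏ i, χ i = 1 := by
  have hm : 0 < Nat.card Γ := Nat.card_pos
  have htop : topExponent k (Nat.card Γ) ∈ invariantExponents χ ↔ ∏ i, χ i = 1 := by
    simp only [mem_invariantExponents, topExponent_apply, Finset.prod_pow]
    refine ⟨fun h => ?_, fun h => by rw [h, one_pow]⟩
    have := MonoidHom.pow_natCard (∏ i, χ i)
    rwa [← Nat.sub_add_cancel hm, pow_succ, h, one_mul] at this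
  rw [← htop]
  exact ⟨topExponent_mem_of_isGorensteinRing hm (fun _ _ => mem_invariantExponents_of_add_mem)
      card_smul_mem_invariantExponents fun i => exists_mem_invariantExponents i (hχ i),
    isGorensteinRing_monomialSubalgebra hm (fun _ _ => mem_invariantExponents_of_add_mem)
      card_smul_mem_invariantExponents⟩

end Characters

section RingEquiv

attribute [local instance] RingHomInvPair.of_ringEquiv in
theorem HasFiniteInjectiveDimension.of_ringEquiv {R R' : Type u} [CommRing R] [CommRing R']
    (e : R ≃+* R') (h : HasFiniteInjectiveDimension R (ModuleCat.of R R)) :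
    HasFiniteInjectiveDimension R' (ModuleCat.of R' R') := by
  obtain ⟨n, hn⟩ := (hasFiniteInjectiveDimension_iff _).1 h
  let e' : ModuleCat.of R R ≃ₛₗ[RingHomClass.toRingHom e] ModuleCat.of R' R' :=
    { e.toAddEquiv with map_smul' := map_mul e }
  have : HasInjectiveDimensionLE (ModuleCat.of R R) n :=
    hasInjectiveDimensionLT_of_ge _ n (n + 1) n.le_succ
  exact (hasFiniteInjectiveDimension_iff _).2
    ⟨n + 1, (ModuleCat.hasInjectiveDimensionLE_iff_of_semiLinearEquiv e e' n).1 this⟩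

theorem IsGorensteinRing.of_ringEquiv {R R' : Type u} [CommRing R] [CommRing R'] (e : R ≃+* R')
    (h : IsGorensteinRing R) : IsGorensteinRing R' := by
  have := h.1
  refine ⟨isNoetherianRing_of_ringEquiv R e, fun P _ => ?_⟩
  let Q := P.comap (e : R →+* R')
  have hQ : Q.primeCompl.map e.toMonoidHom = P.primeCompl := by
    ext x
    constructor
    · rintro ⟨y, hy, rfl⟩
      exact hy
    · intro hx
      exact ⟨e.symm x, fun h => hx (by simpa [Q] using h), e.apply_symm_apply x⟩
  exact (h.2 Q).of_ringEquiv (IsLocalization.ringEquivOfRingEquiv (M := Q.primeCompl)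
    (T := P.primeCompl) (Localization.AtPrime Q) (Localization.AtPrime P) e hQ)

theorem isGorensteinRing_iff_of_ringEquiv {R R' : Type u} [CommRing R] [CommRing R']
    (e : R ≃+* R') : IsGorensteinRing R ↔ IsGorensteinRing R' :=
  ⟨.of_ringEquiv e, .of_ringEquiv e.symm⟩

end RingEquiv

section AdditivePolynomial

variable {R : Type*} [CommRing R] {A : Type*} [AddGroup A] [Fintype A] (j : A →+ R)

/-- The monic polynomial whose roots are the elements `-j a`. -/
def additiveNorm : Polynomial R := ∏ a, (Polynomial.X + Polynomial.C (j a))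

theorem additiveNorm_monic : (additiveNorm j).Monic :=
  Polynomial.monic_prod_of_monic _ _ fun a _ => Polynomial.monic_X_add_C (j a)

theorem natDegree_additiveNorm [Nontrivial R] : (additiveNorm j).natDegree = Fintype.card A := by
  rw [additiveNorm, Polynomial.natDegree_prod_of_monic _ _ fun a _ => Polynomial.monic_X_add_C _]
  simp

theorem additiveNorm_comp (b : A) :
    (additiveNorm j).comp (Polynomial.X + Polynomial.C (j b)) = additiveNorm j := by
  rw [additiveNorm, Polynomial.prod_comp]
  refine Fintype.prod_equiv (Equiv.addLeft b) _ _ fun a => ?_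
  simp [add_assoc]

variable {j} [IsDomain R]

theorem additiveNorm_dvd (hj : Function.Injective j) {f : Polynomial R}
    (hf : ∀ a, f.eval (j a) = 0) : additiveNorm j ∣ f := by
  classical
  by_cases hf0 : f = 0
  · exact hf0 ▸ dvd_zero _
  have h : additiveNorm j =
      ((Finset.univ.val.map fun a => -j a).map fun r => Polynomial.X - Polynomial.C r).prod := by
    rw [Multiset.map_map, additiveNorm, Finset.prod]
    simp
  rw [h, Multiset.prod_X_sub_C_dvd_iff_le_roots hf0, Multiset.le_iff_subset
    (Finset.univ.nodup.map fun a b hab => hj (neg_injective hab))]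
  intro r hr
  obtain ⟨a, -, rfl⟩ := Multiset.mem_map.1 hr
  rw [Polynomial.mem_roots hf0, Polynomial.IsRoot, ← map_neg, hf]

/-- A polynomial that is invariant under a finite group of translations is a polynomial in
the norm of the variable. -/
theorem exists_comp_additiveNorm (hj : Function.Injective j) (f : Polynomial R)
    (hf : ∀ a, f.comp (Polynomial.X + Polynomial.C (j a)) = f) :
    ∃ g : Polynomial R, g.comp (additiveNorm j) = f := by
  induction hn : f.natDegree using Nat.strong_induction_on generalizing f with
  | _ n ih =>
    by_cases h0 : n = 0
    · refine ⟨f, ?_⟩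
      rw [Polynomial.eq_C_of_natDegree_eq_zero (hn.trans h0), Polynomial.C_comp]
    obtain ⟨h, hh⟩ := additiveNorm_dvd (f := f - Polynomial.C (f.eval 0)) hj fun a => by
      have := congr(Polynomial.eval 0 $(hf a))
      rw [Polynomial.eval_comp] at this
      simpa [sub_eq_zero] using this
    have hN := additiveNorm_monic j
    have hh0 : h ≠ 0 := by
      rintro rfl
      rw [mul_zero, sub_eq_zero] at hh
      rw [hh, Polynomial.natDegree_C] at hn
      exact h0 hn.symm
    have hdeg : n = Fintype.card A + h.natDegree := by
      rw [← natDegree_additiveNorm j, ← hN.natDegree_mul' hh0, ← hh, Polynomial.natDegree_sub_C, hn]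
    have hpos : 0 < Fintype.card A := Fintype.card_pos
    obtain ⟨g, hg⟩ := ih h.natDegree (by omega) h (fun a => by
      apply mul_left_cancel₀ hN.ne_zero
      rw [← hh]
      conv_lhs => rw [← additiveNorm_comp j a, ← Polynomial.mul_comp, ← hh]
      rw [Polynomial.sub_comp, Polynomial.C_comp, hf]) rfl
    refine ⟨Polynomial.C (f.eval 0) + Polynomial.X * g, ?_⟩
    rw [Polynomial.add_comp, Polynomial.mul_comp, Polynomial.C_comp, Polynomial.X_comp, hg, ← hh]
    ring

theorem comp_additiveNorm_injective (j : A →+ R) :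
    Function.Injective fun g : Polynomial R => g.comp (additiveNorm j) := by
  intro f g hfg
  rw [← sub_eq_zero] at hfg ⊢
  rw [← Polynomial.sub_comp, Polynomial.comp_eq_zero_iff] at hfg
  refine hfg.resolve_right fun h => ?_
  have := natDegree_additiveNorm j
  rw [h.2, Polynomial.natDegree_C] at this
  exact Fintype.card_ne_zero this.symm

end AdditivePolynomial

section TranslationInvariants

variable {F : Type u} [Field F] {k : ℕ}

/-- Substitution of the polynomial `P` for the first variable. -/
def substHead (P : MvPolynomial (Fin (k + 1)) F) :
    MvPolynomial (Fin (k + 1)) F →ₐ[F] MvPolynomial (Fin (k + 1)) F :=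
  aeval (Fin.cons P fun i => X i.succ)

@[simp] theorem substHead_X_zero (P : MvPolynomial (Fin (k + 1)) F) : substHead P (X 0) = P := by
  simp [substHead]

@[simp] theorem substHead_X_succ (P : MvPolynomial (Fin (k + 1)) F) (i : Fin k) :
    substHead P (X i.succ) = X i.succ := by
  simp [substHead]

theorem finSuccEquiv_substHead (P f : MvPolynomial (Fin (k + 1)) F) :
    finSuccEquiv F k (substHead P f) = (finSuccEquiv F k f).comp (finSuccEquiv F k P) := by
  have h : (finSuccEquiv F k).toAlgHom.comp (substHead P) =
      ((Polynomial.aeval (R := MvPolynomial (Fin k) F) (finSuccEquiv F k P)).restrictScalars F).comp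
        (finSuccEquiv F k).toAlgHom := by
    ext i : 1
    refine Fin.cases ?_ (fun i => ?_) i
    · simp [finSuccEquiv_X_zero]
    · simp [finSuccEquiv_X_succ]
  exact DFunLike.congr_fun h f

variable {A : Type*} [AddGroup A] [Fintype A] {j : A →+ MvPolynomial (Fin k) F}

theorem substHead_additiveNorm_injective (j : A →+ MvPolynomial (Fin k) F) :
    Function.Injective (substHead ((finSuccEquiv F k).symm (additiveNorm j))) := by
  intro f g hfg
  have := congr(finSuccEquiv F k $hfg)
  rw [finSuccEquiv_substHead, finSuccEquiv_substHead, AlgEquiv.apply_symm_apply] at this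
  exact (finSuccEquiv F k).injective (comp_additiveNorm_injective j this)

theorem mem_range_substHead_additiveNorm_iff (hj : Function.Injective j)
    {f : MvPolynomial (Fin (k + 1)) F} :
    f ∈ (substHead ((finSuccEquiv F k).symm (additiveNorm j))).range ↔
      ∀ a, substHead (X 0 + (finSuccEquiv F k).symm (Polynomial.C (j a))) f = f := by
  have hshift (a : A) (f : MvPolynomial (Fin (k + 1)) F) :
      finSuccEquiv F k (substHead (X 0 + (finSuccEquiv F k).symm (Polynomial.C (j a))) f) =
        (finSuccEquiv F k f).comp (Polynomial.X + Polynomial.C (j a)) := by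
    rw [finSuccEquiv_substHead, map_add, finSuccEquiv_X_zero, AlgEquiv.apply_symm_apply]
  constructor
  · rintro ⟨g, rfl⟩ a
    apply (finSuccEquiv F k).injective
    change finSuccEquiv F k (substHead _ (substHead _ g)) = finSuccEquiv F k (substHead _ g)
    rw [hshift, finSuccEquiv_substHead, Polynomial.comp_assoc, AlgEquiv.apply_symm_apply,
      additiveNorm_comp]
  · intro hf
    obtain ⟨g, hg⟩ := exists_comp_additiveNorm hj (finSuccEquiv F k f) fun a => by
      rw [← hshift, hf]
    refine ⟨(finSuccEquiv F k).symm g, (finSuccEquiv F k).injective ?_⟩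
    change finSuccEquiv F k (substHead _ _) = _
    rw [finSuccEquiv_substHead, AlgEquiv.apply_symm_apply, AlgEquiv.apply_symm_apply, hg]

end TranslationInvariants

section DiagonalAction

variable {F : Type u} [Field F] {k : ℕ}

/-- The substitution `X i ↦ r i • X i`. -/
def scaleHom (r : Fin k → F) : MvPolynomial (Fin k) F →ₐ[F] MvPolynomial (Fin k) F :=
  aeval fun i => r i • X i

theorem scaleHom_monomial (r : Fin k → F) (d : Fin k →₀ ℕ) (c : F) :
    scaleHom r (monomial d c) = monomial d (c * ∏ i, r i ^ d i) := by
  rw [scaleHom, aeval_monomial, Finsupp.prod_fintype _ _ fun i => pow_zero _, monomial_eq,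
    Finsupp.prod_fintype _ _ fun i => pow_zero _]
  simp only [algebraMap_eq, smul_eq_C_mul, mul_pow, Finset.prod_mul_distrib, map_mul, map_prod,
    map_pow]
  ring

theorem coeff_scaleHom (r : Fin k → F) (d : Fin k →₀ ℕ) (f : MvPolynomial (Fin k) F) :
    coeff d (scaleHom r f) = coeff d f * ∏ i, r i ^ d i := by
  classical
  induction f using MvPolynomial.induction_on' with
  | add f g hf hg => rw [map_add, coeff_add, coeff_add, hf, hg, add_mul]
  | monomial e c =>
    rw [scaleHom_monomial, coeff_monomial, coeff_monomial]
    split_ifs with h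
    · rw [h]
    · rw [zero_mul]

theorem mem_monomialSubalgebra_invariantExponents_iff {Γ : Type*} [Group Γ]
    {χ : Fin k → Γ →* F} {f : MvPolynomial (Fin k) F} :
    f ∈ monomialSubalgebra F (invariantExponents χ) ↔
      ∀ c, scaleHom (fun i => χ i c) f = f := by
  have hprod (c : Γ) (d : Fin k →₀ ℕ) : ∏ i, χ i c ^ d i = (∏ i, χ i ^ d i) c := by
    rw [MonoidHom.finsetProd_apply]
    simp only [MonoidHom.pow_apply]
  constructor
  · intro hf c
    ext d
    rw [coeff_scaleHom, hprod]
    by_cases hd : d ∈ f.support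
    · rw [mem_invariantExponents.1 (hf d hd), MonoidHom.one_apply, mul_one]
    · rw [notMem_support_iff.1 hd, zero_mul]
  · intro hf d hd
    rw [mem_invariantExponents]
    ext c
    have := congr(coeff d $(hf c))
    rw [coeff_scaleHom, hprod] at this
    exact mul_left_cancel₀ (mem_support_iff.1 hd) (this.trans (mul_one _).symm)

end DiagonalAction

section MatrixAction

variable {F : Type u} [Field F] {k : ℕ}

theorem polyAct_X (M : Matrix (Fin k) (Fin k) F) (i : Fin k) :
    polyAct M (X i) = ∑ j, M i j • X j := by
  simp [polyAct]

theorem polyAct_mul (M N : Matrix (Fin k) (Fin k) F) :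
    polyAct (M * N) = (polyAct N).comp (polyAct M) := by
  ext1 i
  simp only [AlgHom.comp_apply, polyAct_X, map_sum, map_smul, Finset.smul_sum, smul_smul,
    Matrix.mul_apply, Finset.sum_smul]
  exact Finset.sum_comm

theorem polyAct_one : polyAct (1 : Matrix (Fin k) (Fin k) F) = AlgHom.id F _ := by
  ext1 i
  simp [polyAct_X, Matrix.one_apply]

theorem mem_invariantAlg_range {ι : Type*} {M : ι → Matrix (Fin k) (Fin k) F}
    {f : MvPolynomial (Fin k) F} :
    f ∈ invariantAlg (Set.range M) ↔ ∀ i, polyAct (M i) f = f :=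
  Set.forall_mem_range

end MatrixAction

section NormalForm

variable {F : Type u} [Field F] {H : Type*} [Group H]
  {M : H →* Matrix (Fin 3) (Fin 3) F} {α β γ : H →* F} {x : H → F} {T K : Subgroup H}

theorem polyAct_normalForm (hM : ∀ h, M h = !![α h, 0, x h; 0, β h, 0; 0, 0, γ h]) (h : H) :
    polyAct (M h) = aeval ![α h • X 0 + x h • X 2, β h • X 1, γ h • X 2] := by
  ext1 i
  rw [polyAct_X, hM, Fin.sum_univ_three, aeval_X]
  fin_cases i <;> simp

theorem cocycle_of_normalForm (hM : ∀ h, M h = !![α h, 0, x h; 0, β h, 0; 0, 0, γ h]) (g h : H) :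
    x (g * h) = α g * x h + x g * γ h := by
  have := congr($(map_mul M g h) 0 2)
  rw [hM, hM, hM] at this
  simpa [Matrix.mul_apply, Fin.sum_univ_three] using this

theorem normal_of_mem_iff (hT : ∀ h, h ∈ T ↔ α h = 1 ∧ β h = 1 ∧ γ h = 1) : T.Normal where
  conj_mem t ht g := by
    have hconj (δ : H →* F) (h : δ t = 1) : δ (g * t * g⁻¹) = 1 := by
      rw [map_mul, map_mul, h, mul_one, ← map_mul, mul_inv_cancel, map_one]
    obtain ⟨h1, h2, h3⟩ := (hT t).1 ht
    exact (hT _).2 ⟨hconj α h1, hconj β h2, hconj γ h3⟩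

theorem conj_of_cocycle (hx : ∀ g h, x (g * h) = α g * x h + x g * γ h) {t : H} (hα : α t = 1)
    (hγ : γ t = 1) (g : H) : α g * x (g⁻¹ * t * g) = γ g * x t := by
  have h1 := hx g (g⁻¹ * t * g)
  have h2 := hx t g
  have h3 : γ (g⁻¹ * t * g) = 1 := by
    rw [map_mul, map_mul, hγ, mul_one, ← map_mul, inv_mul_cancel, map_one]
  rw [h3, ← mul_assoc, ← mul_assoc, mul_inv_cancel, one_mul, h2, hα] at h1
  linear_combination -h1

theorem eq_one_of_mem_of_eq_zero (hM : ∀ h, M h = !![α h, 0, x h; 0, β h, 0; 0, 0, γ h])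
    (hT : ∀ h, h ∈ T ↔ α h = 1 ∧ β h = 1 ∧ γ h = 1)
    (hinj : Function.Injective M) {t : H} (ht : t ∈ T) (hx : x t = 0) : t = 1 := by
  have hx1 : x 1 = 0 := by simpa using cocycle_of_normalForm hM 1 1
  apply hinj
  obtain ⟨ha, hb, hc⟩ := (hT _).1 ht
  rw [hM, hM, ha, hb, hc, hx, map_one, map_one, map_one, hx1]

variable (x) in
/-- The translations of the first variable by the elements of `T`. -/
def translationHom (hadd : ∀ s ∈ T, ∀ t ∈ T, x (s * t) = x s + x t) :
    Additive T →+ MvPolynomial (Fin 2) F :=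
  AddMonoidHom.mk' (fun t => x (t.toMul : H) • X 1) fun s t => by
    rw [← add_smul, ← hadd _ s.toMul.2 _ t.toMul.2]
    rfl

theorem finSuccEquiv_symm_C_smul_X (r : F) :
    (finSuccEquiv F 2).symm (Polynomial.C (r • X 1)) = r • X 2 := by
  rw [AlgEquiv.symm_apply_eq, ← Polynomial.smul_C, map_smul]
  exact congr(r • $(finSuccEquiv_X_succ (R := F) (j := (1 : Fin 2)))).symm

theorem isGorensteinRing_invariantAlg_range_iff [Finite H]
    (hM : ∀ h, M h = !![α h, 0, x h; 0, β h, 0; 0, 0, γ h])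
    (hT : ∀ h, h ∈ T ↔ α h = 1 ∧ β h = 1 ∧ γ h = 1) (hTK : T.IsComplement' K)
    (hK : ∀ c ∈ K, x c = 0) (hinj : Function.Injective M) :
    IsGorensteinRing (invariantAlg (Set.range M)) ↔
      IsGorensteinRing (monomialSubalgebra F (invariantExponents
        ![(α ^ Nat.card T).comp K.subtype, β.comp K.subtype, γ.comp K.subtype])) := by
  have := normal_of_mem_iff hT
  have hadd (s) (hs : s ∈ T) (t) (ht : t ∈ T) : x (s * t) = x s + x t := by
    rw [cocycle_of_normalForm hM, ((hT s).1 hs).1, ((hT t).1 ht).2.2, one_mul, mul_one, add_comm]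
  let j := translationHom x hadd
  have hj : Function.Injective j := by
    rw [injective_iff_map_eq_zero]
    intro t ht
    have hx : x (t.toMul : H) = 0 := by
      have h1 : x (t.toMul : H) • (X 1 : MvPolynomial (Fin 2) F) = 0 := ht
      exact (smul_eq_zero.1 h1).resolve_right (X_ne_zero 1)
    exact Subtype.ext (eq_one_of_mem_of_eq_zero hM hT hinj t.toMul.2 hx)
  have hjt (t : H) (ht : t ∈ T) : j (Additive.ofMul ⟨t, ht⟩) = x t • X 1 := rfl
  let _ := Fintype.ofFinite T
  let φ := substHead ((finSuccEquiv F 2).symm (additiveNorm j))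
  have hφ : Function.Injective φ := substHead_additiveNorm_injective j
  have hN : (finSuccEquiv F 2).symm (additiveNorm j) = ∏ t : T, (X 0 + x t • X 2) := by
    rw [additiveNorm, map_prod]
    refine Fintype.prod_equiv Additive.toMul _ _ fun t => ?_
    rw [map_add, ← finSuccEquiv_X_zero, AlgEquiv.symm_apply_apply]
    exact congr(X 0 + $(finSuccEquiv_symm_C_smul_X _))
  have hpolyT (t : H) (ht : t ∈ T) : polyAct (M t) =
      substHead (X 0 + (finSuccEquiv F 2).symm (Polynomial.C (j (Additive.ofMul ⟨t, ht⟩)))) := by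
    obtain ⟨ha, hb, hc⟩ := (hT _).1 ht
    rw [polyAct_normalForm hM, ha, hb, hc]
    ext1 i
    have h1 := finSuccEquiv_symm_C_smul_X (x t)
    refine Fin.cases ?_ (fun i => ?_) i
    · rw [substHead_X_zero]
      rw [aeval_X, hjt t ht, h1]
      simp
    · rw [substHead_X_succ]
      fin_cases i <;> simp
  have hpolyK (c : K) : (polyAct (M c)).comp φ = φ.comp (scaleHom fun i =>
      (![(α ^ Nat.card T).comp K.subtype, β.comp K.subtype, γ.comp K.subtype] i : K →* F) c) := by
    rw [polyAct_normalForm hM, hK c c.2]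
    ext1 i
    refine Fin.cases ?_ (fun i => ?_) i
    · rw [AlgHom.comp_apply, AlgHom.comp_apply, substHead_X_zero, scaleHom, aeval_X, map_smul,
        substHead_X_zero, hN, map_prod]
      have h1 (t : T) : aeval (R := F) (S₁ := MvPolynomial (Fin 3) F)
          ![α c • X 0 + (0 : F) • X 2, β c • X 1, γ c • X 2] (X 0 + x t • X 2) =
          α c • (X 0 + x (MulAut.conjNormal (c : H)⁻¹ t) • X 2) := by
        rw [MulAut.conjNormal_apply, inv_inv, smul_add, smul_smul,
          conj_of_cocycle (cocycle_of_normalForm hM) ((hT _).1 t.2).1 ((hT _).1 t.2).2.2]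
        simp [smul_smul, mul_comm]
      rw [Fintype.prod_congr _ _ h1, Finset.prod_smul, Finset.prod_const,
        Finset.card_univ, ← Nat.card_eq_fintype_card]
      congr 1
      exact Fintype.prod_equiv (MulAut.conjNormal (c : H)⁻¹).toEquiv _ _ fun t => rfl
    · rw [AlgHom.comp_apply, AlgHom.comp_apply, substHead_X_succ, scaleHom, aeval_X, aeval_X,
        map_smul, substHead_X_succ]
      fin_cases i <;> simp
  have hmap : invariantAlg (Set.range M) = (monomialSubalgebra F (invariantExponents
      ![(α ^ Nat.card T).comp K.subtype, β.comp K.subtype, γ.comp K.subtype])).map φ := by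
    ext f
    rw [mem_invariantAlg_range, Subalgebra.mem_map]
    constructor
    · intro hf
      obtain ⟨g, rfl⟩ := (mem_range_substHead_additiveNorm_iff hj (f := f)).2 fun t => by
        exact (congr($(hpolyT _ t.toMul.2) f)).symm.trans (hf _)
      refine ⟨g, mem_monomialSubalgebra_invariantExponents_iff.2 fun c => hφ ?_, rfl⟩
      exact congr($(hpolyK c) g).symm.trans (hf c)
    · rintro ⟨g, hg, rfl⟩ h
      obtain ⟨⟨t, c⟩, rfl⟩ := hTK.surjective h
      change polyAct (M (t * c)) _ = _
      have hg' : substHead _ (φ g) = φ g :=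
        (mem_range_substHead_additiveNorm_iff hj).1 ⟨g, rfl⟩ (Additive.ofMul ⟨t, t.2⟩)
      rw [map_mul, polyAct_mul, AlgHom.comp_apply, hpolyT _ t.2]
      change polyAct (M c) (substHead _ (φ g)) = φ g
      rw [hg']
      exact congr($(hpolyK c) g).trans
        congr(φ $(mem_monomialSubalgebra_invariantExponents_iff.1 hg c))
  rw [hmap]
  exact isGorensteinRing_iff_of_ringEquiv
    (Subalgebra.equivMapOfInjective _ φ hφ).symm.toRingEquiv

theorem eq_one_of_pow_prime_pow_eq_one (p : ℕ) [Fact p.Prime] [CharP F p] {n : ℕ} {a : F}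
    (ha : a ^ p ^ n = 1) : a = 1 := by
  simpa using (ExpChar.pow_prime_pow_mul_eq_one_iff p n 1 a).1 (by rwa [mul_one])

theorem pow_card_sub_one_eq_of_normalForm [Finite H]
    (hM : ∀ h, M h = !![α h, 0, x h; 0, β h, 0; 0, 0, γ h])
    (hT : ∀ h, h ∈ T ↔ α h = 1 ∧ β h = 1 ∧ γ h = 1)
    (hinj : Function.Injective M) (c : H) :
    α c ^ (Nat.card T - 1) = γ c ^ (Nat.card T - 1) := by
  classical
  have := normal_of_mem_iff hT
  let _ := Fintype.ofFinite T
  have hP : ∏ t ∈ (Finset.univ : Finset T).erase 1, x t ≠ 0 := by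
    refine Finset.prod_ne_zero_iff.2 fun t ht hx => (Finset.mem_erase.1 ht).1 ?_
    exact Subtype.ext (eq_one_of_mem_of_eq_zero hM hT hinj t.2 hx)
  have hcard : ((Finset.univ : Finset T).erase 1).card = Nat.card T - 1 := by
    rw [Finset.card_erase_of_mem (Finset.mem_univ _), Finset.card_univ, Nat.card_eq_fintype_card]
  have hperm : ∏ t ∈ (Finset.univ : Finset T).erase 1, x (MulAut.conjNormal c⁻¹ t : T) =
      ∏ t ∈ (Finset.univ : Finset T).erase 1, x t :=
    Finset.prod_equiv (MulAut.conjNormal c⁻¹).toEquiv (fun t => by simp) fun t _ => rfl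
  refine mul_right_cancel₀ hP ?_
  rw [← hcard, ← Finset.prod_const, ← Finset.prod_const]
  conv_lhs => rw [← hperm]
  rw [← Finset.prod_mul_distrib, ← Finset.prod_mul_distrib]
  refine Finset.prod_congr rfl fun t _ => ?_
  rw [MulAut.conjNormal_apply, inv_inv, conj_of_cocycle (cocycle_of_normalForm hM) ((hT _).1 t.2).1 ((hT _).1 t.2).2.2]

theorem isGorensteinRing_invariantAlg_range_iff_pow_mem [Finite H] (p : ℕ) [Fact p.Prime]
    [CharP F p] {n : ℕ} (hM : ∀ h, M h = !![α h, 0, x h; 0, β h, 0; 0, 0, γ h])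
    (hT : ∀ h, h ∈ T ↔ α h = 1 ∧ β h = 1 ∧ γ h = 1) (hTK : T.IsComplement' K)
    (hK : ∀ c ∈ K, x c = 0) (hinj : Function.Injective M)
    (hdet : ∀ h, α h * β h * γ h = 1) (hcard : Nat.card T = p ^ n) :
    IsGorensteinRing (invariantAlg (Set.range M)) ↔ ∀ h, h ^ (p ^ n - 1) ∈ T := by
  have hp : p ^ n ≠ 0 := pow_ne_zero _ (Fact.out : p.Prime).ne_zero
  rw [isGorensteinRing_invariantAlg_range_iff hM hT hTK hK hinj, hcard,
    isGorensteinRing_invariantExponents_iff]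
  · have hprod (c : K) : (∏ i, ![(α ^ p ^ n).comp K.subtype, β.comp K.subtype,
        γ.comp K.subtype] i) c = α c ^ (p ^ n - 1) := by
      rw [Fin.prod_univ_three, MonoidHom.mul_apply, MonoidHom.mul_apply]
      change α c ^ p ^ n * β c * γ c = _
      conv_lhs => rw [← Nat.sub_add_cancel (Nat.one_le_iff_ne_zero.2 hp), pow_succ]
      rw [mul_assoc, mul_assoc, ← mul_assoc (α c), hdet, mul_one]
    constructor
    · intro hχ h
      obtain ⟨⟨t, c⟩, rfl⟩ := hTK.surjective h
      obtain ⟨ha, hb, hc⟩ := (hT _).1 t.2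
      have h1 : α c ^ (p ^ n - 1) = 1 := by rw [← hprod, hχ, MonoidHom.one_apply]
      have h2 : γ c ^ (p ^ n - 1) = 1 := by
        rw [← h1, ← hcard, pow_card_sub_one_eq_of_normalForm hM hT hinj]
      have h3 : β c ^ (p ^ n - 1) = 1 := by
        have := congr($(hdet c) ^ (p ^ n - 1))
        rwa [mul_pow, mul_pow, h1, h2, one_mul, mul_one, one_pow] at this
      rw [hT]
      simp [ha, hb, hc, h1, h2, h3]
    · intro h
      ext c
      rw [hprod, ← map_pow, ((hT _).1 (h c)).1, MonoidHom.one_apply]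
  · have hKT (c : K) (ha : α c = 1) (hb : β c = 1) (hc : γ c = 1) : c = 1 :=
      Subtype.ext (Subgroup.disjoint_def.1 hTK.disjoint ((hT _).2 ⟨ha, hb, hc⟩) c.2)
    intro i c hc
    have h0 : i ≠ 0 → α c = 1 := fun h => eq_one_of_pow_prime_pow_eq_one p (hc 0 h.symm)
    have h1 : i ≠ 1 → β c = 1 := fun h => hc 1 h.symm
    have h2 : i ≠ 2 → γ c = 1 := fun h => hc 2 h.symm
    have hd := hdet c
    fin_cases i
    · have hb := h1 (by decide)
      have hc := h2 (by decide)
      exact hKT c (by rwa [hb, hc, mul_one, mul_one] at hd) hb hc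
    · have ha := h0 (by decide)
      have hc := h2 (by decide)
      exact hKT c ha (by rwa [ha, hc, mul_one, one_mul] at hd) hc
    · have ha := h0 (by decide)
      have hb := h1 (by decide)
      exact hKT c ha hb (by rwa [ha, hb, mul_one, one_mul] at hd)

end NormalForm

section Conjugation

variable {F : Type u} [Field F] {k : ℕ} {H : Type*}

theorem isGorensteinRing_invariantAlg_range_iff_of_intertwining
    {M M' : H → Matrix (Fin k) (Fin k) F} {P P' : Matrix (Fin k) (Fin k) F} (hP : P * P' = 1)
    (h : ∀ g, P * M g = M' g * P) :
    IsGorensteinRing (invariantAlg (Set.range M)) ↔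
      IsGorensteinRing (invariantAlg (Set.range M')) := by
  have hP' : P' * P = 1 := mul_eq_one_comm.1 hP
  have hinv (f : MvPolynomial (Fin k) F) : polyAct P (polyAct P' f) = f := by
    rw [← AlgHom.comp_apply, ← polyAct_mul, hP', polyAct_one, AlgHom.id_apply]
  have hinj : Function.Injective (polyAct P) := by
    refine Function.LeftInverse.injective (g := polyAct P') fun f => ?_
    rw [← AlgHom.comp_apply, ← polyAct_mul, hP, polyAct_one, AlgHom.id_apply]
  have hcomp (g : H) (f : MvPolynomial (Fin k) F) :
      polyAct (M g) (polyAct P f) = polyAct P (polyAct (M' g) f) := by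
    rw [← AlgHom.comp_apply, ← AlgHom.comp_apply, ← polyAct_mul, ← polyAct_mul, h]
  have hmap : invariantAlg (Set.range M) = (invariantAlg (Set.range M')).map (polyAct P) := by
    ext f
    rw [Subalgebra.mem_map, mem_invariantAlg_range]
    constructor
    · intro hf
      refine ⟨polyAct P' f, mem_invariantAlg_range.2 fun g => hinj ?_, hinv f⟩
      rw [← hcomp, hinv, hf]
    · rintro ⟨f, hf, rfl⟩ g
      rw [hcomp, mem_invariantAlg_range.1 hf]
  rw [hmap]
  exact isGorensteinRing_iff_of_ringEquiv
    (Subalgebra.equivMapOfInjective _ (polyAct P) hinj).symm.toRingEquiv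

theorem exists_conj_monoidHom [Group H] {n : Type*} [Fintype n] [DecidableEq n] (M : H →* Matrix n n F)
    (hM : Function.Injective M) {P P' : Matrix n n F} (hP : P * P' = 1) :
    ∃ M' : H →* Matrix n n F, (∀ g, M' g = P * M g * P') ∧ Function.Injective M' := by
  have hP' : P' * P = 1 := mul_eq_one_comm.1 hP
  refine ⟨⟨⟨fun g => P * M g * P', by rw [map_one, mul_one, hP]⟩, fun g h => ?_⟩,
    fun g => rfl, fun g h hgh => hM ?_⟩
  · calc P * M (g * h) * P' = P * M g * (P' * P) * M h * P' := by
          rw [hP', map_mul]; noncomm_ring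
      _ = _ := by noncomm_ring
  · have : P' * (P * M g * P') * P = P' * (P * M h * P') * P := congr(P' * $hgh * P)
    calc M g = (P' * P) * M g * (P' * P) := by rw [hP', one_mul, mul_one]
      _ = P' * (P * M g * P') * P := by noncomm_ring
      _ = _ := this
      _ = (P' * P) * M h * (P' * P) := by noncomm_ring
      _ = M h := by rw [hP', one_mul, mul_one]

end Conjugation

section BlockForm

variable {F : Type u} [Field F] {H : Type*} [Group H]
  {M : H →* Matrix (Fin 3) (Fin 3) F} {α β γ : H →* F} {x y : H → F} {T K : Subgroup H}

theorem exists_eq_mul_sub_of_cocycle [Finite K]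
    (hx : ∀ g h, x (g * h) = α g * x h + x g * γ h) (hK : (Nat.card K : F) ≠ 0) :
    ∃ s, ∀ c ∈ K, x c = s * (α c - γ c) := by
  let _ := Fintype.ofFinite K
  have hγ (c : H) : γ c ≠ 0 := ((Group.isUnit c).map γ).ne_zero
  let S : F := ∑ d : K, x d / γ d
  have hS (c : K) : γ c * S = α c * S + Nat.card K * x c := by
    have h1 : S = ∑ d : K, x (c * d : H) / γ (c * d : H) :=
      (Fintype.sum_equiv (Equiv.mulLeft c) _ _ fun d => rfl).symm
    have h2 (d : K) : γ c * (x (c * d : H) / γ (c * d : H)) = α c * (x d / γ d) + x c := by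
      have := hγ c
      have := hγ d
      rw [hx, map_mul]
      field_simp
    conv_lhs => rw [h1]
    rw [Finset.mul_sum, Finset.sum_congr rfl fun d _ => h2 d, Finset.sum_add_distrib,
      ← Finset.mul_sum, Finset.sum_const, Finset.card_univ, ← Nat.card_eq_fintype_card,
      nsmul_eq_mul]
  refine ⟨-S / Nat.card K, fun c hc => ?_⟩
  have := hS ⟨c, hc⟩
  field_simp
  linear_combination -this

theorem cocycles_of_blockForm (hM : ∀ h, M h = !![α h, 0, x h; 0, β h, y h; 0, 0, γ h])
    (g h : H) : x (g * h) = α g * x h + x g * γ h ∧ y (g * h) = β g * y h + y g * γ h := by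
  have h1 := congr($(map_mul M g h) 0 2)
  have h2 := congr($(map_mul M g h) 1 2)
  rw [hM, hM, hM] at h1 h2
  exact ⟨by simpa [Matrix.mul_apply, Fin.sum_univ_three] using h1,
    by simpa [Matrix.mul_apply, Fin.sum_univ_three] using h2⟩

theorem not_dvd_index_of_mem_iff [Finite H] (p : ℕ) [Fact p.Prime] [CharP F p]
    (hT : ∀ h, h ∈ T ↔ α h = 1 ∧ β h = 1 ∧ γ h = 1) : ¬p ∣ T.index := by
  have := normal_of_mem_iff hT
  intro hdvd
  obtain ⟨g, hg⟩ := exists_prime_orderOf_dvd_card' (G := H ⧸ T) p hdvd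
  obtain ⟨g, rfl⟩ := QuotientGroup.mk_surjective g
  have h1 := pow_orderOf_eq_one (g : H ⧸ T)
  rw [hg, ← QuotientGroup.mk_pow, QuotientGroup.eq_one_iff, hT] at h1
  simp only [map_pow] at h1
  have hroot {a : F} (ha : a ^ p = 1) : a = 1 :=
    eq_one_of_pow_prime_pow_eq_one p (n := 1) (by rwa [pow_one])
  have h2 : g ∈ T := (hT g).2 ⟨hroot h1.1, hroot h1.2.1, hroot h1.2.2⟩
  rw [(QuotientGroup.eq_one_iff g).2 h2, orderOf_one] at hg
  exact (Fact.out : p.Prime).one_lt.ne hg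

theorem isGorensteinRing_invariantAlg_range_iff_of_blockForm_of_eq_zero [Finite H] (p : ℕ)
    [Fact p.Prime] [CharP F p] {n : ℕ}
    (hM : ∀ h, M h = !![α h, 0, x h; 0, β h, y h; 0, 0, γ h])
    (hT : ∀ h, h ∈ T ↔ α h = 1 ∧ β h = 1 ∧ γ h = 1) (hinj : Function.Injective M)
    (hdet : ∀ h, α h * β h * γ h = 1) (hcard : Nat.card T = p ^ n) (hy : ∀ t ∈ T, y t = 0) :
    IsGorensteinRing (invariantAlg (Set.range M)) ↔ ∀ h, h ^ (p ^ n - 1) ∈ T := by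
  have := normal_of_mem_iff hT
  have hdvd : ¬p ∣ T.index := not_dvd_index_of_mem_iff p hT
  obtain ⟨K, hTK⟩ := Subgroup.exists_right_complement'_of_coprime (N := T) (by
    rw [hcard]
    exact Nat.Coprime.pow_left _ ((Fact.out : p.Prime).coprime_iff_not_dvd.2 hdvd))
  have hcardK : (Nat.card K : F) ≠ 0 := by
    rwa [hTK.symm.index_eq_card.symm, Ne, CharP.cast_eq_zero_iff F p]
  obtain ⟨s, hs⟩ := exists_eq_mul_sub_of_cocycle
    (fun g h => (cocycles_of_blockForm hM g h).1) hcardK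
  obtain ⟨r, hr⟩ := exists_eq_mul_sub_of_cocycle
    (fun g h => (cocycles_of_blockForm hM g h).2) hcardK
  have hP : !![1, 0, s; 0, 1, r; 0, 0, 1] * !![1, 0, -s; 0, 1, -r; 0, 0, 1] =
      (1 : Matrix (Fin 3) (Fin 3) F) := by
    ext i j
    fin_cases i <;> fin_cases j <;> simp [Matrix.mul_apply, Fin.sum_univ_three]
  obtain ⟨M', hM', hinj'⟩ := exists_conj_monoidHom M hinj hP
  have hform (h : H) : M' h = !![α h, 0, x h - s * (α h - γ h);
      0, β h, y h - r * (β h - γ h); 0, 0, γ h] := by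
    rw [hM', hM]
    ext i j
    fin_cases i <;> fin_cases j <;> simp [Matrix.mul_apply, Fin.sum_univ_three]
    · ring
    · ring
  have hy' (h : H) : y h - r * (β h - γ h) = 0 := by
    obtain ⟨⟨t, c⟩, rfl⟩ := hTK.surjective h
    obtain ⟨-, hb, hc⟩ := (hT _).1 t.2
    have h1 := (cocycles_of_blockForm hM t c).2
    change y (t * c) - r * (β (t * c) - γ (t * c)) = 0
    rw [h1, hy t t.2, hr c c.2, map_mul, map_mul, hb, hc]
    ring
  rw [isGorensteinRing_invariantAlg_range_iff_of_intertwining (M' := M') hP fun g => by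
    rw [hM', mul_assoc (_ * _), mul_eq_one_comm.1 hP, mul_one]]
  refine isGorensteinRing_invariantAlg_range_iff_pow_mem p
    (x := fun h => x h - s * (α h - γ h)) (fun h => ?_) hT hTK (fun c hc => ?_) hinj' hdet hcard
  · rw [hform, hy']
  · rw [hs c hc, sub_self]

theorem isGorensteinRing_invariantAlg_range_iff_of_blockForm [Finite H] (p : ℕ)
    [Fact p.Prime] [CharP F p] {n : ℕ}
    (hM : ∀ h, M h = !![α h, 0, x h; 0, β h, y h; 0, 0, γ h])
    (hT : ∀ h, h ∈ T ↔ α h = 1 ∧ β h = 1 ∧ γ h = 1) (hinj : Function.Injective M)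
    (hdet : ∀ h, α h * β h * γ h = 1) (hcard : Nat.card T = p ^ n) {a b : F}
    (hline : ∀ t ∈ T, ∃ μ, x t = μ * a ∧ y t = μ * b) :
    IsGorensteinRing (invariantAlg (Set.range M)) ↔ ∀ h, h ^ (p ^ n - 1) ∈ T := by
  by_cases hy : ∀ t ∈ T, y t = 0
  · exact isGorensteinRing_invariantAlg_range_iff_of_blockForm_of_eq_zero p hM hT hinj hdet hcard hy
  by_cases hx : ∀ t ∈ T, x t = 0
  · have hP : !![0, 1, 0; 1, 0, 0; 0, 0, 1] * !![0, 1, 0; 1, 0, 0; 0, 0, 1] =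
        (1 : Matrix (Fin 3) (Fin 3) F) := by
      ext i j
      fin_cases i <;> fin_cases j <;> simp [Matrix.mul_apply, Fin.sum_univ_three]
    obtain ⟨M', hM', hinj'⟩ := exists_conj_monoidHom M hinj hP
    rw [isGorensteinRing_invariantAlg_range_iff_of_intertwining (M' := M') hP fun g => by
      rw [hM', mul_assoc (_ * _), hP, mul_one]]
    refine isGorensteinRing_invariantAlg_range_iff_of_blockForm_of_eq_zero p (α := β) (β := α)
      (γ := γ) (x := y) (y := x) (fun h => ?_) (fun h => ?_) hinj' (fun h => ?_) hcard hx
    · rw [hM', hM]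
      ext i j
      fin_cases i <;> fin_cases j <;> simp [Matrix.mul_apply, Fin.sum_univ_three]
    · rw [hT, and_left_comm]
    · rw [mul_comm (β h), hdet]
  push Not at hx hy
  obtain ⟨t₀, ht₀, hx₀⟩ := hx
  obtain ⟨t₁, ht₁, hy₁⟩ := hy
  have ha : a ≠ 0 := fun h => hx₀ <| by
    obtain ⟨μ, hμ, -⟩ := hline t₀ ht₀
    rw [hμ, h, mul_zero]
  have hb : b ≠ 0 := fun h => hy₁ <| by
    obtain ⟨μ, -, hμ⟩ := hline t₁ ht₁
    rw [hμ, h, mul_zero]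
  have hαβ (g : H) : α g = β g := by
    have := normal_of_mem_iff hT
    obtain ⟨hα, hβ, hγ⟩ := (hT t₀).1 ht₀
    have h1 := conj_of_cocycle (fun g h => (cocycles_of_blockForm hM g h).1) hα hγ g
    have h2 := conj_of_cocycle (fun g h => (cocycles_of_blockForm hM g h).2) hβ hγ g
    obtain ⟨μ, hμ, hμ'⟩ := hline t₀ ht₀
    obtain ⟨ν, hν, hν'⟩ := hline (g⁻¹ * t₀ * g) (this.conj_mem' t₀ ht₀ g)
    have hμ0 : μ ≠ 0 := fun h => hx₀ (by rw [hμ, h, zero_mul])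
    have hγ0 : γ g ≠ 0 := ((Group.isUnit g).map γ).ne_zero
    rw [hμ, hν, ← mul_assoc, ← mul_assoc] at h1
    rw [hμ', hν', ← mul_assoc, ← mul_assoc] at h2
    have h3 := mul_right_cancel₀ ha h1
    have h4 := mul_right_cancel₀ hb h2
    have hν0 : ν ≠ 0 := fun h => mul_ne_zero hγ0 hμ0 (by rw [← h3, h, mul_zero])
    exact mul_right_cancel₀ hν0 (h3.trans h4.symm)
  have hP : !![1, 0, 0; b, -a, 0; 0, 0, 1] * !![1, 0, 0; b / a, -1 / a, 0; 0, 0, 1] =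
      (1 : Matrix (Fin 3) (Fin 3) F) := by
    ext i j
    fin_cases i <;> fin_cases j <;> simp [Matrix.mul_apply, Fin.sum_univ_three]
    all_goals field_simp
    all_goals ring
  obtain ⟨M', hM', hinj'⟩ := exists_conj_monoidHom M hinj hP
  rw [isGorensteinRing_invariantAlg_range_iff_of_intertwining (M' := M') hP fun g => by
    rw [hM', mul_assoc (_ * _), mul_eq_one_comm.1 hP, mul_one]]
  refine isGorensteinRing_invariantAlg_range_iff_of_blockForm_of_eq_zero p (x := x)
    (y := fun h => b * x h - a * y h) (fun h => ?_) hT hinj' hdet hcard fun t ht => ?_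
  · rw [hM', hM, hαβ]
    ext i j
    fin_cases i <;> fin_cases j <;> simp [Matrix.mul_apply, Fin.sum_univ_three]
    all_goals field_simp
    all_goals ring
  · obtain ⟨μ, h1, h2⟩ := hline t ht
    rw [h1, h2]
    ring

end BlockForm

section Transvections

variable {F : Type u} [Field F]

theorem isTransvectionMat_iff_of_blockForm {r s t x y : F} :
    IsTransvectionMat !![r, 0, x; 0, s, y; 0, 0, t] ↔
      (r = 1 ∧ s = 1 ∧ t = 1) ∧ !![r, 0, x; 0, s, y; 0, 0, t] ≠ 1 := by
  constructor
  · rintro ⟨h1, h2⟩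
    have h (i : Fin 3) := congr($h2 i i)
    have h00 := h 0
    have h11 := h 1
    have h22 := h 2
    simp [Matrix.mul_apply, Fin.sum_univ_three, sub_eq_zero] at h00 h11 h22
    refine ⟨⟨h00, h11, h22⟩, fun h => ?_⟩
    simp [h] at h1
  · rintro ⟨⟨rfl, rfl, rfl⟩, hne⟩
    have hM : !![1, 0, x; 0, 1, y; 0, 0, 1] - 1 =
        vecMulVec ![x, y, 0] (![0, 0, 1] : Fin 3 → F) := by
      ext i j
      fin_cases i <;> fin_cases j <;> simp [vecMulVec_apply]
    refine ⟨le_antisymm ?_ (Nat.one_le_iff_ne_zero.2 fun h => hne ?_), ?_⟩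
    · rw [hM]
      exact rank_vecMulVec_le _ _
    · rw [Matrix.rank, Submodule.finrank_eq_zero, LinearMap.range_eq_bot, ← toLin'_apply',
        map_eq_zero_iff _ toLin'.injective] at h
      exact sub_eq_zero.1 h
    · rw [hM, vecMulVec_mul_vecMulVec]
      simp

end Transvections

/-- Chapter B, case `dim span X = 1`: with all transvection directions on a
single line `F·(a, b)` and `|T(G)| = pⁿ`, the ring `S(V)^G` is Gorenstein iff every element
of `G/T(G)` has order dividing `pⁿ - 1` (i.e. `g^{pⁿ-1} ∈ T(G)` for all `g ∈ G`). -/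
theorem stmt10 (p : ℕ) [Fact p.Prime] (F : Type u) [Field F] [CharP F p]
    (G : Subgroup (Matrix.SpecialLinearGroup (Fin 3) F)) [Finite G]
    (hblock : ∀ g ∈ G, (g : Matrix (Fin 3) (Fin 3) F) 0 1 = 0 ∧
      (g : Matrix (Fin 3) (Fin 3) F) 1 0 = 0 ∧ (g : Matrix (Fin 3) (Fin 3) F) 2 0 = 0 ∧
      (g : Matrix (Fin 3) (Fin 3) F) 2 1 = 0)
    (a b : F) (hab : ¬(a = 0 ∧ b = 0))
    (hline : ∀ σ ∈ G, IsTransvectionMat (σ : Matrix (Fin 3) (Fin 3) F) →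
      ∃ μ : F, (σ : Matrix (Fin 3) (Fin 3) F) 0 2 = μ * a ∧
        (σ : Matrix (Fin 3) (Fin 3) F) 1 2 = μ * b)
    (n : ℕ) (hcard : Nat.card ↥(transSubgroup G) = p ^ n) :
    IsGorensteinRing ↥(invariantRing G) ↔
      ∀ g ∈ G, g ^ (p ^ n - 1) ∈ transSubgroup G := by
  let M : G →* Matrix (Fin 3) (Fin 3) F :=
    SpecialLinearGroup.coeMonoidHom.comp G.subtype
  have hMinj : Function.Injective M := 
    Subtype.val_injective.comp Subtype.val_injective
  obtain ⟨α, β, γ, hM⟩ : ∃ α β γ : G →* F,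
      ∀ g, M g = !![α g, 0, M g 0 2; 0, β g, M g 1 2; 0, 0, γ g] := by
    have hdiag (i : Fin 3) (g h : G) : M (g * h) i i = M g i i * M h i i := by
      obtain ⟨h1, h2, h3, h4⟩ := hblock g g.2
      obtain ⟨h5, h6, h7, h8⟩ := hblock h h.2
      rw [map_mul, Matrix.mul_apply, Fin.sum_univ_three]
      fin_cases i <;> simp [M, h1, h2, h3, h4, h5, h6, h7, h8]
    let δ (i : Fin 3) : G →* F := ⟨⟨fun g => M g i i, by rw [map_one, one_apply_eq]⟩, hdiag i⟩
    refine ⟨δ 0, δ 1, δ 2, fun g => ?_⟩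
    obtain ⟨h1, h2, h3, h4⟩ := hblock g g.2
    ext i j
    fin_cases i <;> fin_cases j
    all_goals first | rfl | assumption
  let T : Subgroup G := α.ker ⊓ β.ker ⊓ γ.ker
  have hT (h : G) : h ∈ T ↔ α h = 1 ∧ β h = 1 ∧ γ h = 1 := by
    simp [T, and_assoc]
  have htrans (h : G) : IsTransvectionMat (M h) ↔ h ∈ T ∧ h ≠ 1 := by
    rw [hT, hM, isTransvectionMat_iff_of_blockForm, ← hM, ← map_one M, hMinj.ne_iff]
  have htransT : transSubgroup G = T.map G.subtype := by
    refine le_antisymm ((Subgroup.closure_le _).2 fun g hg => ?_) ?_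
    · exact ⟨⟨g, hg.1⟩, ((htrans ⟨g, hg.1⟩).1 hg.2).1, rfl⟩
    · rintro _ ⟨g, hg, rfl⟩
      by_cases h1 : g = 1
      · rw [h1]
        exact one_mem _
      · exact Subgroup.subset_closure ⟨g.2, (htrans g).2 ⟨hg, h1⟩⟩
  have hcardT : Nat.card T = p ^ n := by
    rw [← hcard, htransT]
    exact (Subgroup.card_map_of_injective G.subtype_injective).symm
  have hdet (g : G) : α g * β g * γ g = 1 := by
    have h1 : (M g).det = 1 := Matrix.SpecialLinearGroup.det_coe _
    rw [hM, det_fin_three] at h1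
    simpa using h1
  have hinv : invariantRing G = invariantAlg (Set.range M) := by
    rw [invariantRing]
    congr 1
    ext N
    simp [M]
  rw [hinv, isGorensteinRing_invariantAlg_range_iff_of_blockForm p hM hT hMinj hdet hcardT
    (a := a) (b := b) fun t ht => ?_, htransT]
  · constructor
    · exact fun h g hg => ⟨⟨g, hg⟩ ^ (p ^ n - 1), h ⟨g, hg⟩, rfl⟩
    · rintro h ⟨g, hg⟩
      obtain ⟨t, ht, htg⟩ := h g hg
      rwa [show (⟨g, hg⟩ : G) ^ (p ^ n - 1) = t from Subtype.ext htg.symm]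
  · by_cases h1 : t = 1
    · refine ⟨0, ?_⟩
      simp [h1]
    · exact hline t t.2 ((htrans t).2 ⟨ht, h1⟩)

end
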